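/- arXiv:1804.10674 — 5 statements merged into one kernel-verified Lean document; each statement's English description precedes it below -/
import Mathlib

section
/- Let X and Y be real normed spaces, T : S_X → S_Y a surjective isometry, and F ⊂ S_X an intersection face. Then for every λ ∈ [−1,1], one has T(F_λ) = (T(F))_λ. -/
open Pointwise

variable {X : Type*} [NormedAddCommGroup X] [NormedSpace ℝ X]

/-- A *face* of the closed unit ball `B_X`: a nonempty convex subset `F ⊆ B_X` such that
whenever a point of an open segment contained in `B_X` lies in `F`, the whole segment
lies in `F`. -/
def IsFace (F : Set X) : Prop :=
  F.Nonempty ∧ Convex ℝ F ∧ IsExtreme ℝ (Metric.closedBall (0 : X) 1) F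

/-- A *maximal face* of the unit sphere `S_X`: a face of `B_X` contained in `S_X` that is
maximal among proper faces of `B_X`. -/
def IsMaximalFace (F : Set X) : Prop :=
  IsFace F ∧ F ⊆ Metric.sphere (0 : X) 1 ∧
    ∀ G : Set X, IsFace G → G ≠ Metric.closedBall (0 : X) 1 → F ⊆ G → F = G

/-- An *intersection face*: a closed face `F ⊆ S_X` which is the intersection of all
maximal faces of `S_X` containing it. -/
def IsIntersectionFace (F : Set X) : Prop :=
  IsClosed F ∧ IsFace F ∧ F ⊆ Metric.sphere (0 : X) 1 ∧
    F = ⋂₀ {E : Set X | IsMaximalFace E ∧ F ⊆ E}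

/-- For `E ⊆ S_X` and `λ ∈ [-1,1]`,
`E_λ = {x ∈ S_X : dist (x, E) ≤ 1 - λ and dist (x, -E) ≤ 1 + λ}`. -/
noncomputable def lamFace (E : Set X) (lam : ℝ) : Set X :=
  {x ∈ Metric.sphere (0 : X) 1 |
    Metric.infDist x E ≤ 1 - lam ∧ Metric.infDist x (-E) ≤ 1 + lam}

/-- The star of `x` in the unit sphere: the points `y` of the sphere with `‖x + y‖ = 2`. -/
def sphereStar (x : X) : Set X :=
  {y ∈ Metric.sphere (0 : X) 1 | ‖x + y‖ = 2}

/-- A maximal convex subset of the unit sphere. -/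
def IsMaximalConvex (C : Set X) : Prop :=
  Maximal (fun D : Set X => Convex ℝ D ∧ D ⊆ Metric.sphere (0 : X) 1) C

theorem norm_add_eq_two_of_convex {C : Set X} (hC : Convex ℝ C)
    (hS : C ⊆ Metric.sphere (0 : X) 1) {x y : X} (hx : x ∈ C) (hy : y ∈ C) :
    ‖x + y‖ = 2 := by
  have h : (1 / 2 : ℝ) • x + (1 / 2 : ℝ) • y ∈ C :=
    hC hx hy (by norm_num) (by norm_num) (by norm_num)
  have h1 : ‖(1 / 2 : ℝ) • x + (1 / 2 : ℝ) • y‖ = 1 := by simpa using hS h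
  rw [← smul_add, norm_smul] at h1
  norm_num at h1
  linarith

/-- If a convex combination of two points of the ball is at distance two from `-w`, then so is
each point that occurs with positive weight. -/
theorem norm_add_eq_two_of_combination {a b w : X} {s t : ℝ} (ha : ‖a‖ ≤ 1) (hb : ‖b‖ ≤ 1)
    (hw : ‖w‖ ≤ 1) (hs : 0 < s) (ht : 0 ≤ t) (hst : s + t = 1)
    (h : ‖(s • a + t • b) + w‖ = 2) : ‖a + w‖ = 2 := by
  have h1 : (s • a + t • b) + w = s • (a + w) + t • (b + w) := by
    have : w = (s + t) • w := by rw [hst, one_smul]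
    nth_rewrite 1 [this]
    module
  have h2 : ‖(s • a + t • b) + w‖ ≤ s * ‖a + w‖ + t * ‖b + w‖ := by
    rw [h1]
    refine (norm_add_le _ _).trans ?_
    rw [norm_smul, norm_smul, Real.norm_of_nonneg hs.le, Real.norm_of_nonneg ht]
  have h3 := norm_add_le a w
  have h4 := norm_add_le b w
  refine le_antisymm (by linarith) ?_
  by_contra! h5
  nlinarith

theorem norm_combination_eq_one {x y : X} {s t : ℝ} (hx : ‖x‖ = 1) (hy : ‖y‖ = 1)
    (hs : 0 ≤ s) (ht : 0 ≤ t) (hst : s + t = 1) (h : ‖x + y‖ = 2) :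
    ‖s • x + t • y‖ = 1 := by
  have h1 : ‖s • x + t • y‖ ≤ 1 := by
    refine (norm_add_le _ _).trans ?_
    rw [norm_smul, norm_smul, Real.norm_of_nonneg hs, Real.norm_of_nonneg ht, hx, hy]
    linarith
  have h2 : ‖t • x + s • y‖ ≤ 1 := by
    refine (norm_add_le _ _).trans ?_
    rw [norm_smul, norm_smul, Real.norm_of_nonneg hs, Real.norm_of_nonneg ht, hx, hy]
    linarith
  have h3 : x + y = (s • x + t • y) + (t • x + s • y) := by
    obtain rfl : t = 1 - s := by linarith
    module
  have h4 := norm_add_le (s • x + t • y) (t • x + s • y)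
  rw [← h3, h] at h4
  linarith

theorem exists_isMaximalConvex {P : Set X} (hP : Convex ℝ P)
    (hS : P ⊆ Metric.sphere (0 : X) 1) : ∃ C, P ⊆ C ∧ IsMaximalConvex C := by
  refine zorn_subset_nonempty {D : Set X | Convex ℝ D ∧ D ⊆ Metric.sphere (0 : X) 1} ?_ P ⟨hP, hS⟩
  intro c hc hchain _
  exact ⟨⋃₀ c, ⟨hchain.directedOn.convex_sUnion fun A hA => (hc hA).1,
    Set.sUnion_subset fun A hA => (hc hA).2⟩, fun A hA => Set.subset_sUnion_of_mem hA⟩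

theorem IsMaximalConvex.mem_of_forall {C : Set X} (hC : IsMaximalConvex C) {y : X}
    (hy : ‖y‖ = 1) (h : ∀ x ∈ C, ‖x + y‖ = 2) : y ∈ C := by
  rcases C.eq_empty_or_nonempty with rfl | hne
  · exact hC.2 (y := {y}) ⟨convex_singleton y, by simpa using hy⟩ (Set.empty_subset _) rfl
  · have hsub : convexHull ℝ (insert y C) ⊆ Metric.sphere (0 : X) 1 := by
      rw [convexHull_insert hne, hC.1.1.convexHull_eq, convexJoin_singleton_left]
      intro z hz
      simp only [Set.mem_iUnion] at hz
      obtain ⟨x, hx, s, t, hs, ht, hst, rfl⟩ := hz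
      have hx1 : ‖x‖ = 1 := by simpa using hC.1.2 hx
      simpa using norm_combination_eq_one hy hx1 hs ht hst (by rw [add_comm]; exact h x hx)
    exact hC.2 ⟨convex_convexHull ℝ _, hsub⟩
      ((Set.subset_insert y C).trans (subset_convexHull ℝ _))
      (subset_convexHull ℝ _ (Set.mem_insert y C))

theorem IsMaximalConvex.norm_add {C : Set X} (hC : IsMaximalConvex C) {x y : X}
    (hx : x ∈ C) (hy : y ∈ C) : ‖x + y‖ = 2 :=
  norm_add_eq_two_of_convex hC.1.1 hC.1.2 hx hy

theorem IsMaximalConvex.norm_eq {C : Set X} (hC : IsMaximalConvex C) {x : X}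
    (hx : x ∈ C) : ‖x‖ = 1 := by simpa using hC.1.2 hx

theorem IsMaximalConvex.isFace {C : Set X} (hC : IsMaximalConvex C) (hne : C.Nonempty) :
    IsFace C := by
  refine ⟨hne, hC.1.1, fun x hx => Metric.sphere_subset_closedBall (hC.1.2 hx), ?_⟩
  rintro a ha b hb z hz ⟨s, t, hs, ht, hst, rfl⟩
  have ha' : ‖a‖ ≤ 1 := by simpa using ha
  have hb' : ‖b‖ ≤ 1 := by simpa using hb
  have key : ∀ w ∈ C, ‖a + w‖ = 2 := fun w hw =>
    norm_add_eq_two_of_combination ha' hb' (hC.norm_eq hw).le hs ht.le hst (hC.norm_add hz hw)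
  obtain ⟨w, hw⟩ := hne
  have h1 := norm_add_le a w
  rw [key w hw, hC.norm_eq hw] at h1
  exact hC.mem_of_forall (by linarith) fun x hx => by rw [add_comm]; exact key x hx

theorem IsMaximalFace.isMaximalConvex {E : Set X} (hE : IsMaximalFace E) :
    IsMaximalConvex E := by
  obtain ⟨hface, hS, hmax⟩ := hE
  obtain ⟨C, hEC, hC⟩ := exists_isMaximalConvex hface.2.1 hS
  have hne : C ≠ Metric.closedBall (0 : X) 1 := by
    rintro rfl
    simpa using hC.norm_eq (x := (0 : X)) (by simp)
  rwa [hmax C (hC.isFace (hface.1.mono hEC)) hne hEC]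

theorem exists_isMaximalConvex_pair {x y : X} (hx : ‖x‖ = 1) (hy : ‖y‖ = 1)
    (h : ‖x + y‖ = 2) : ∃ C, IsMaximalConvex C ∧ x ∈ C ∧ y ∈ C := by
  have hS : segment ℝ x y ⊆ Metric.sphere (0 : X) 1 := by
    rintro z ⟨s, t, hs, ht, hst, rfl⟩
    simpa using norm_combination_eq_one hx hy hs ht hst h
  obtain ⟨C, hsub, hC⟩ := exists_isMaximalConvex (convex_segment x y) hS
  exact ⟨C, hC, hsub (left_mem_segment ℝ x y), hsub (right_mem_segment ℝ x y)⟩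

/-- A maximal convex set through `z` contains every `x` whose star contains the star of `z`. -/
theorem IsMaximalConvex.mem_of_sphereStar_subset {C : Set X} (hC : IsMaximalConvex C) {x z : X}
    (hz : z ∈ C) (hx : ‖x‖ = 1) (h : sphereStar z ⊆ sphereStar x) : x ∈ C :=
  hC.mem_of_forall hx fun w hw => by
    rw [add_comm]
    exact (h ⟨hC.1.2 hw, hC.norm_add hz hw⟩).2

theorem norm_add_eq_two_of_sphereStar_subset {x y z : X} (hx : ‖x‖ = 1) (hy : ‖y‖ = 1)
    (hz : ‖z‖ = 1) (hzx : sphereStar z ⊆ sphereStar x) (hzy : sphereStar z ⊆ sphereStar y) :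
    ‖x + y‖ = 2 := by
  obtain ⟨C, hC, hzC, -⟩ := exists_isMaximalConvex_pair hz hz (by
    rw [← two_smul ℝ z, norm_smul, hz]; norm_num)
  exact hC.norm_add (hC.mem_of_sphereStar_subset hzC hx hzx)
    (hC.mem_of_sphereStar_subset hzC hy hzy)

/-- Convex subsets of the sphere are directed for reverse inclusion of stars. -/
theorem exists_sphereStar_subset {C : Set X} (hC : Convex ℝ C)
    (hS : C ⊆ Metric.sphere (0 : X) 1) {x y : X} (hx : x ∈ C) (hy : y ∈ C) :
    ∃ z ∈ C, sphereStar z ⊆ sphereStar x ∧ sphereStar z ⊆ sphereStar y := by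
  have hx1 : ‖x‖ = 1 := by simpa using hS hx
  have hy1 : ‖y‖ = 1 := by simpa using hS hy
  refine ⟨(1 / 2 : ℝ) • x + (1 / 2 : ℝ) • y,
    hC hx hy (by norm_num) (by norm_num) (by norm_num), ?_, ?_⟩
  · rintro w ⟨hw, h⟩
    exact ⟨hw, norm_add_eq_two_of_combination hx1.le hy1.le (by simpa using hw.le)
      (by norm_num) (by norm_num) (by norm_num) h⟩
  · rintro w ⟨hw, h⟩
    rw [add_comm ((1 / 2 : ℝ) • x)] at h
    exact ⟨hw, norm_add_eq_two_of_combination hy1.le hx1.le (by simpa using hw.le)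
      (by norm_num) (by norm_num) (by norm_num) h⟩

/-- A subset of the sphere that is directed for reverse inclusion of stars lies in a maximal
convex subset of the sphere. -/
theorem exists_isMaximalConvex_of_directed {P : Set X} (hS : P ⊆ Metric.sphere (0 : X) 1)
    (hP : ∀ x ∈ P, ∀ y ∈ P, ∃ z ∈ P, sphereStar z ⊆ sphereStar x ∧ sphereStar z ⊆ sphereStar y) :
    ∃ C, P ⊆ C ∧ IsMaximalConvex C := by
  let Q : Set X := {y ∈ Metric.sphere (0 : X) 1 | ∃ z ∈ P, sphereStar z ⊆ sphereStar y}
  have hQ : Convex ℝ Q := by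
    rintro x ⟨hx, p, hp, hpx⟩ y ⟨hy, q, hq, hqy⟩ s t hs ht hst
    obtain ⟨z, hz, hzp, hzq⟩ := hP p hp q hq
    have hx1 : ‖x‖ = 1 := by simpa using hx
    have hy1 : ‖y‖ = 1 := by simpa using hy
    have hz1 : ‖z‖ = 1 := by simpa using hS hz
    have hxy := norm_add_eq_two_of_sphereStar_subset hx1 hy1 hz1 (hzp.trans hpx) (hzq.trans hqy)
    refine ⟨by simpa using norm_combination_eq_one hx1 hy1 hs ht hst hxy, z, hz, ?_⟩
    rintro u ⟨hu, hzu⟩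
    obtain ⟨C, hC, hzC, huC⟩ := exists_isMaximalConvex_pair hz1 (by simpa using hu) hzu
    exact ⟨hu, hC.norm_add (hC.1.1 (hC.mem_of_sphereStar_subset hzC hx1 (hzp.trans hpx))
      (hC.mem_of_sphereStar_subset hzC hy1 (hzq.trans hqy)) hs ht hst) huC⟩
  obtain ⟨C, hQC, hC⟩ := exists_isMaximalConvex hQ fun y hy => hy.1
  exact ⟨C, fun x hx => hQC ⟨hS hx, x, hx, subset_rfl⟩, hC⟩

theorem sphereStar_subset_iff_of_isometry {V W : Type*} [NormedAddCommGroup V]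
    [NormedAddCommGroup W] {T : V → W}
    (hiso : ∀ x ∈ Metric.sphere (0 : V) 1, ∀ y ∈ Metric.sphere (0 : V) 1,
      dist (T x) (T y) = dist x y)
    (hsurj : T '' Metric.sphere (0 : V) 1 = Metric.sphere (0 : W) 1)
    {x z : V} (hx : x ∈ Metric.sphere (0 : V) 1) (hz : z ∈ Metric.sphere (0 : V) 1) :
    sphereStar (T z) ⊆ sphereStar (T x) ↔ sphereStar z ⊆ sphereStar x := by
  have key : ∀ p ∈ Metric.sphere (0 : V) 1, ∀ u ∈ Metric.sphere (0 : V) 1,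
      ‖T p + -T u‖ = ‖p + -u‖ := fun p hp u hu => by
    simpa [dist_eq_norm, sub_eq_add_neg] using hiso p hp u hu
  constructor
  · rintro h u ⟨hu, hzu⟩
    have hu' : -u ∈ Metric.sphere (0 : V) 1 := by simpa using hu
    have hTu : T (-u) ∈ Metric.sphere (0 : W) 1 := hsurj ▸ Set.mem_image_of_mem T hu'
    have h1 : -T (-u) ∈ sphereStar (T z) :=
      ⟨by simpa using hTu, by rw [key z hz _ hu', neg_neg, hzu]⟩
    have h2 := (h h1).2
    rw [key x hx _ hu', neg_neg] at h2
    exact ⟨hu, h2⟩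
  · rintro h v ⟨hv, hzv⟩
    have hv' : -v ∈ T '' Metric.sphere (0 : V) 1 := by rw [hsurj]; simpa using hv
    obtain ⟨u, hu, huv⟩ := hv'
    obtain rfl : v = -T u := by rw [huv, neg_neg]
    rw [key z hz u hu] at hzv
    refine ⟨hv, ?_⟩
    rw [key x hx u hu]
    exact (h ⟨by simpa using hu, hzv⟩).2

theorem infDist_image_of_isometry_on {M N : Type*} [PseudoMetricSpace M]
    [PseudoMetricSpace N] {T : M → N} {S : Set M}
    (hiso : ∀ x ∈ S, ∀ y ∈ S, dist (T x) (T y) = dist x y)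
    {E : Set M} (hE : E ⊆ S) {x : M} (hx : x ∈ S) :
    Metric.infDist (T x) (T '' E) = Metric.infDist x E := by
  unfold Metric.infDist Metric.infEDist
  rw [iInf_image]
  congr 1
  refine iInf_congr fun y => iInf_congr fun hy => ?_
  rw [edist_dist, edist_dist, hiso x hx y (hE hy)]

section SphereIsometry

variable {Y : Type*} [NormedAddCommGroup Y] [NormedSpace ℝ Y] {T : X → Y}

theorem IsMaximalConvex.image
    (hiso : ∀ x ∈ Metric.sphere (0 : X) 1, ∀ y ∈ Metric.sphere (0 : X) 1,
      dist (T x) (T y) = dist x y)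
    (hsurj : T '' Metric.sphere (0 : X) 1 = Metric.sphere (0 : Y) 1)
    {C : Set X} (hC : IsMaximalConvex C) : IsMaximalConvex (T '' C) := by
  have hS : T '' C ⊆ Metric.sphere (0 : Y) 1 := hsurj ▸ Set.image_mono hC.1.2
  obtain ⟨M, hCM, hM⟩ := exists_isMaximalConvex_of_directed hS (by
    rintro _ ⟨x, hx, rfl⟩ _ ⟨y, hy, rfl⟩
    obtain ⟨z, hz, hzx, hzy⟩ := exists_sphereStar_subset hC.1.1 hC.1.2 hx hy
    have hzS := hC.1.2 hz
    exact ⟨T z, Set.mem_image_of_mem T hz,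
      (sphereStar_subset_iff_of_isometry hiso hsurj (hC.1.2 hx) hzS).2 hzx,
      (sphereStar_subset_iff_of_isometry hiso hsurj (hC.1.2 hy) hzS).2 hzy⟩)
  have hMC : M ⊆ T '' C := by
    intro y hy
    obtain ⟨b, hb, rfl⟩ : y ∈ T '' Metric.sphere (0 : X) 1 := hsurj ▸ hM.1.2 hy
    refine Set.mem_image_of_mem T (hC.mem_of_forall (by simpa using hb) fun x hx => ?_)
    obtain ⟨z, hz, hzx, hzb⟩ := exists_sphereStar_subset hM.1.1 hM.1.2
      (hCM (Set.mem_image_of_mem T hx)) hy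
    obtain ⟨c, hc, rfl⟩ : z ∈ T '' Metric.sphere (0 : X) 1 := hsurj ▸ hM.1.2 hz
    exact norm_add_eq_two_of_sphereStar_subset (hC.norm_eq hx) (by simpa using hb)
      (by simpa using hc)
      ((sphereStar_subset_iff_of_isometry hiso hsurj (hC.1.2 hx) hc).1 hzx)
      ((sphereStar_subset_iff_of_isometry hiso hsurj hb hc).1 hzb)
  rwa [hCM.antisymm hMC]

/-- For intersection faces, a surjective isometry between unit spheres commutes with the
antipodal map. -/
theorem IsIntersectionFace.image_neg
    (hiso : ∀ x ∈ Metric.sphere (0 : X) 1, ∀ y ∈ Metric.sphere (0 : X) 1,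
      dist (T x) (T y) = dist x y)
    (hsurj : T '' Metric.sphere (0 : X) 1 = Metric.sphere (0 : Y) 1)
    {F : Set X} (hF : IsIntersectionFace F) : T '' (-F) = -(T '' F) := by
  obtain ⟨-, -, hS, hEq⟩ := hF
  have hmem : ∀ b, (∀ C, IsMaximalConvex C → F ⊆ C → b ∈ C) → b ∈ F := fun b hb => by
    rw [hEq]
    exact fun C hC => hb C hC.1.isMaximalConvex hC.2
  have hnegS : ∀ {x : X}, x ∈ Metric.sphere (0 : X) 1 → -x ∈ Metric.sphere (0 : X) 1 :=
    fun hx => by simpa using hx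
  have hTS : ∀ {x : X}, x ∈ Metric.sphere (0 : X) 1 → T x ∈ Metric.sphere (0 : Y) 1 :=
    fun hx => hsurj ▸ Set.mem_image_of_mem T hx
  have hnorm : ∀ p ∈ Metric.sphere (0 : X) 1, ∀ u ∈ Metric.sphere (0 : X) 1,
      ‖T p + -T (-u)‖ = ‖p + u‖ := fun p hp u hu => by
    simpa [dist_eq_norm, sub_eq_add_neg] using hiso p hp (-u) (hnegS hu)
  apply Set.Subset.antisymm
  · rintro _ ⟨x, hx, rfl⟩
    rw [Set.mem_neg] at hx ⊢
    have hxS : x ∈ Metric.sphere (0 : X) 1 := by simpa using hnegS (hS hx)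
    obtain ⟨b, hb, hbx⟩ : -T x ∈ T '' Metric.sphere (0 : X) 1 := by
      rw [hsurj]; simpa using hTS hxS
    refine ⟨b, hmem b fun C hC hFC => ?_, hbx⟩
    have hbC : T b ∈ T '' C := by
      refine (hC.image hiso hsurj).mem_of_forall (by simpa using hTS hb) ?_
      rintro _ ⟨y, hy, rfl⟩
      have h := hnorm y (hC.1.2 hy) (-x) (hnegS hxS)
      rw [neg_neg] at h
      rw [hbx, h]
      exact hC.norm_add hy (hFC hx)
    obtain ⟨c, hc, hcb⟩ := hbC
    have h := hiso c (hC.1.2 hc) b hb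
    rw [hcb, dist_self] at h
    rwa [← dist_eq_zero.1 h.symm]
  · intro y hy
    obtain ⟨x, hx, hxy⟩ := Set.mem_neg.1 hy
    obtain rfl : y = -T x := by rw [hxy, neg_neg]
    obtain ⟨b, hb, hbx⟩ : -T x ∈ T '' Metric.sphere (0 : X) 1 := by
      rw [hsurj]; simpa using hTS (hS hx)
    refine ⟨b, Set.mem_neg.2 (hmem _ fun C hC hFC => ?_), hbx⟩
    refine hC.mem_of_forall (by simpa using hb) fun w hw => ?_
    rw [← hnorm w (hC.1.2 hw) _ (hnegS hb), neg_neg, hbx, neg_neg]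
    exact (hC.image hiso hsurj).norm_add (Set.mem_image_of_mem T hw)
      (Set.mem_image_of_mem T (hFC hx))

end SphereIsometry

/-- If `T : S_X → S_Y` is a surjective isometry and `F ⊆ S_X` an intersection face, then
`T(F_λ) = (T F)_λ` for every `λ ∈ [-1,1]`. -/
theorem image_lamFace
    (Y : Type*) [NormedAddCommGroup Y] [NormedSpace ℝ Y]
    (T : X → Y)
    (hiso : ∀ x ∈ Metric.sphere (0 : X) 1, ∀ y ∈ Metric.sphere (0 : X) 1,
      dist (T x) (T y) = dist x y)
    (hsurj : T '' Metric.sphere (0 : X) 1 = Metric.sphere (0 : Y) 1)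
    (F : Set X) (hF : IsIntersectionFace F) :
    ∀ lam ∈ Set.Icc (-1 : ℝ) 1, T '' lamFace F lam = lamFace (T '' F) lam := by
  intro lam _
  have hS : F ⊆ Metric.sphere (0 : X) 1 := hF.2.2.1
  have hnegS : -F ⊆ Metric.sphere (0 : X) 1 := fun x hx => by simpa using hS hx
  have key : ∀ x ∈ Metric.sphere (0 : X) 1, T x ∈ lamFace (T '' F) lam ↔ x ∈ lamFace F lam := by
    intro x hx
    have hTx : T x ∈ Metric.sphere (0 : Y) 1 := hsurj ▸ Set.mem_image_of_mem T hx
    simp only [lamFace, Set.mem_ofPred_eq, hx, hTx, true_and,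
      ← hF.image_neg hiso hsurj, infDist_image_of_isometry_on hiso hS hx,
      infDist_image_of_isometry_on hiso hnegS hx]
  ext y
  constructor
  · rintro ⟨x, hx, rfl⟩
    exact (key x hx.1).2 hx
  · intro hy
    obtain ⟨x, hx, rfl⟩ : y ∈ T '' Metric.sphere (0 : X) 1 := hsurj ▸ hy.1
    exact ⟨x, (key x hx).1 hy, rfl⟩
end

section
/- Let X be a real normed space and E ⊂ S_X a face of the closed unit ball contained in the unit sphere. Then for any λ₁, λ₂ ∈ [−1,1] and α ∈ [0,1], one has (α E_{λ₁} + (1−α) E_{λ₂}) ∩ S_X ⊂ E_{αλ₁ + (1−α)λ₂}. -/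
open Pointwise

variable {X : Type*} [NormedAddCommGroup X] [NormedSpace ℝ X]

/-- The distance to a nonempty convex set is a convex function. -/
theorem Convex.convexOn_infDist {s : Set X} (hs : Convex ℝ s) (hne : s.Nonempty) :
    ConvexOn ℝ Set.univ (fun x => Metric.infDist x s) := by
  refine ⟨convex_univ, fun x _ y _ a b ha hb hab => ?_⟩
  refine le_of_forall_pos_lt_add fun ε hε => ?_
  obtain ⟨u, hu, hxu⟩ := (Metric.infDist_lt_iff hne).1 (lt_add_of_pos_right (Metric.infDist x s) hε)
  obtain ⟨v, hv, hyv⟩ := (Metric.infDist_lt_iff hne).1 (lt_add_of_pos_right (Metric.infDist y s) hε)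
  calc Metric.infDist (a • x + b • y) s
      ≤ dist (a • x + b • y) (a • u + b • v) :=
        Metric.infDist_le_dist_of_mem (hs hu hv ha hb hab)
    _ ≤ dist (a • x) (a • u) + dist (b • y) (b • v) := dist_add_add_le _ _ _ _
    _ = a * dist x u + b * dist y v := by
        rw [dist_smul₀, dist_smul₀, Real.norm_of_nonneg ha, Real.norm_of_nonneg hb]
    _ < a * (Metric.infDist x s + ε) + b * (Metric.infDist y s + ε) := by
        rcases ha.eq_or_lt with rfl | ha
        · obtain rfl : b = 1 := by linarith
          linarith
        · exact add_lt_add_of_lt_of_le (mul_lt_mul_of_pos_left hxu ha)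
            (mul_le_mul_of_nonneg_left hyv.le hb)
    _ = a • Metric.infDist x s + b • Metric.infDist y s + ε := by
        simp only [smul_eq_mul]
        linear_combination ε * hab

/-- For a face `E ⊆ S_X` of the closed unit ball, `λ₁, λ₂ ∈ [-1,1]` and `α ∈ [0,1]`,
`(α E_{λ₁} + (1-α) E_{λ₂}) ∩ S_X ⊆ E_{α λ₁ + (1-α) λ₂}`. -/
theorem smul_add_lamFace_subset
    (E : Set X) (hE : IsFace E) (hEs : E ⊆ Metric.sphere (0 : X) 1)
    (lam₁ lam₂ : ℝ) (h₁ : lam₁ ∈ Set.Icc (-1 : ℝ) 1) (h₂ : lam₂ ∈ Set.Icc (-1 : ℝ) 1)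
    (α : ℝ) (hα : α ∈ Set.Icc (0 : ℝ) 1) :
    (α • lamFace E lam₁ + (1 - α) • lamFace E lam₂) ∩ Metric.sphere (0 : X) 1 ⊆
      lamFace E (α * lam₁ + (1 - α) * lam₂) := by
  rintro _ ⟨⟨_, ⟨x, ⟨-, hx, hx'⟩, rfl⟩, _, ⟨y, ⟨-, hy, hy'⟩, rfl⟩, rfl⟩, hs⟩
  obtain ⟨hne, hconv, -⟩ := hE
  have hα₀ := hα.1
  have hβ₀ : 0 ≤ 1 - α := sub_nonneg.2 hα.2
  have hsum : α + (1 - α) = 1 := add_sub_cancel _ _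
  have hpos := (hconv.convexOn_infDist hne).2 (Set.mem_univ x) (Set.mem_univ y) hα₀ hβ₀ hsum
  have hneg := (hconv.neg.convexOn_infDist hne.neg).2 (Set.mem_univ x) (Set.mem_univ y)
    hα₀ hβ₀ hsum
  simp only [smul_eq_mul] at hpos hneg
  refine ⟨hs, hpos.trans ?_, hneg.trans ?_⟩
  · linarith [mul_le_mul_of_nonneg_left hx hα₀, mul_le_mul_of_nonneg_left hy hβ₀]
  · linarith [mul_le_mul_of_nonneg_left hx' hα₀, mul_le_mul_of_nonneg_left hy' hβ₀]
end

section
/- Let A be a unital complex C*-algebra, φ a pure state on A, and L := {a ∈ A : φ(a*a) = 0} the associated closed left ideal. Let (e_n)_n be an approximate unit for the C*-subalgebra L ∩ L*. Then any bounded linear functional θ on A with ‖θ‖ ≤ 1 satisfying lim_n θ(1 − e_n) = 1 coincides with φ. -/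
open Filter

/-- A *state* on a unital complex C*-algebra: a positive linear functional of norm one. -/
def IsState (A : Type*) [CStarAlgebra A] (φ : A →L[ℂ] ℂ) : Prop :=
  ‖φ‖ = 1 ∧ ∀ a : A, ∃ r : ℝ, 0 ≤ r ∧ φ (star a * a) = (r : ℂ)

/-- A *pure state*: an extreme point of the state space. -/
def IsPureState (A : Type*) [CStarAlgebra A] (φ : A →L[ℂ] ℂ) : Prop :=
  φ ∈ Set.extremePoints ℝ {ψ : A →L[ℂ] ℂ | IsState A ψ}

open scoped ComplexOrder InnerProductSpace

namespace PositiveLinearMap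

variable {A : Type*} [CStarAlgebra A] [PartialOrder A] [StarOrderedRing A]

/-- The Cauchy–Schwarz inequality for a positive functional. -/
lemma norm_apply_star_mul_sq_le (f : A →ₚ[ℂ] ℂ) (a b : A) :
    ‖f (star a * b)‖ ^ 2 ≤ (f (star a * a)).re * (f (star b * b)).re := by
  have h := norm_inner_le_norm (𝕜 := ℂ) (f.toPreGNS a) (f.toPreGNS b)
  have key (x : A) : ‖f.toPreGNS x‖ ^ 2 = (f (star x * x)).re := by
    simpa [← Complex.ofReal_pow] using congrArg Complex.re (f.preGNS_norm_sq (f.toPreGNS x))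
  rw [← key, ← key, ← mul_pow]
  gcongr
  simpa [preGNS_inner_def] using h

lemma re_apply_mono {A : Type*} [CStarAlgebra A] [PartialOrder A] (f : A →ₚ[ℂ] ℂ) {a b : A}
    (h : a ≤ b) : (f a).re ≤ (f b).re :=
  (Complex.le_def.1 (OrderHomClass.mono f h)).1

lemma ofReal_re_apply (f : A →ₚ[ℂ] ℂ) {a : A} (ha : IsSelfAdjoint a) :
    ((f a).re : ℂ) = f a := by
  have h1 := f.map_nonneg (CFC.posPart_nonneg a)
  have h2 := f.map_nonneg (CFC.negPart_nonneg a)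
  have h3 : f a = f a⁺ - f a⁻ := by rw [← map_sub, CFC.posPart_sub_negPart a ha]
  rw [h3]
  apply Complex.ext
  · simp
  · simp [← (Complex.le_def.1 h1).2, ← (Complex.le_def.1 h2).2]

lemma re_apply_star_mul_self_le (f : A →ₚ[ℂ] ℂ) (a : A) :
    (f (star a * a)).re ≤ ‖a‖ ^ 2 * (f 1).re := by
  have h := f.re_apply_mono (CStarAlgebra.star_mul_le_algebraMap_norm_sq (a := a))
  rwa [Algebra.algebraMap_eq_smul_one, f.map_smul_of_tower, Complex.smul_re, smul_eq_mul] at h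

lemma re_apply_star_mul_self_real_smul (f : A →ₚ[ℂ] ℂ) (a : A) (t : ℝ) :
    (f (star (t • a) * (t • a))).re = t ^ 2 * (f (star a * a)).re := by
  rw [star_smul, smul_mul_smul_comm, f.map_smul_of_tower, Complex.smul_re]
  simp [sq]

lemma norm_apply_le (f : A →ₚ[ℂ] ℂ) (a : A) : ‖f a‖ ≤ (f 1).re * ‖a‖ := by
  have h0 : 0 ≤ (f 1).re := (Complex.le_def.1 (f.map_nonneg zero_le_one)).1
  refine le_of_sq_le_sq ?_ (by positivity)
  have h := f.norm_apply_star_mul_sq_le 1 a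
  simp only [star_one, one_mul] at h
  calc _ ≤ _ := h
    _ ≤ (f 1).re * (‖a‖ ^ 2 * (f 1).re) := by gcongr; exact f.re_apply_star_mul_self_le a
    _ = _ := by ring

lemma apply_star_mul_self_congr (f : A →ₚ[ℂ] ℂ) {x y : A}
    (h : f (star (x - y) * (x - y)) = 0) : f (star x * x) = f (star y * y) := by
  have key (x : A) : (‖f.toPreGNS x‖ : ℂ) ^ 2 = f (star x * x) := f.preGNS_norm_sq _
  have h0 : ‖f.toPreGNS x - f.toPreGNS y‖ = 0 := by
    rw [← map_sub]
    rw [← key] at h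
    exact_mod_cast pow_eq_zero_iff two_ne_zero |>.1 h
  have h1 := abs_norm_sub_norm_le (f.toPreGNS x) (f.toPreGNS y)
  rw [h0, abs_nonpos_iff, sub_eq_zero] at h1
  rw [← key, ← key, h1]

/-- A contractive functional that is unital is positive. -/
lemma _root_.ContinuousLinearMap.apply_nonneg_of_norm_le_one [Nontrivial A]
    (θ : A →L[ℂ] ℂ) (hθ : ‖θ‖ ≤ 1)
    (h1 : θ 1 = 1) {a : A} (ha : 0 ≤ a) : 0 ≤ θ a := by
  have bound (x : A) : ‖θ x‖ ≤ ‖x‖ := by simpa using θ.le_of_opNorm_le hθ x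
  have hsa : star a = a := (IsSelfAdjoint.of_nonneg ha).star_eq
  rw [Complex.le_def]
  constructor
  · have hn : ‖algebraMap ℝ A ‖a‖ - a‖ ≤ ‖a‖ := by
      rw [CStarAlgebra.norm_le_iff_le_algebraMap _ (norm_nonneg a)
        (sub_nonneg.2 (IsSelfAdjoint.le_algebraMap_norm_self (.of_nonneg ha)))]
      simpa using ha
    have h2 := (Complex.re_le_norm _).trans ((bound _).trans hn)
    rw [Algebra.algebraMap_eq_smul_one, map_sub, θ.map_smul_of_tower, h1] at h2
    simpa using h2
  · have key (s : ℝ) : ((θ a).im + s) ^ 2 ≤ ‖a‖ ^ 2 + s ^ 2 := by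
      set x : A := a + (Complex.I * s) • 1 with hx
      have hs : star x * x = a * a + ((s : ℂ) ^ 2) • 1 := by
        simp only [hx, star_add, star_smul, hsa, star_one, add_mul, mul_add, smul_mul_assoc,
          one_mul, mul_smul_comm, mul_one]
        have : star (Complex.I * s) = -(Complex.I * s) := by simp
        rw [this]
        have h3 : Complex.I * s * (Complex.I * s) = -(s : ℂ) ^ 2 := by
          linear_combination ((s : ℂ) ^ 2) * Complex.I_sq
        simp only [neg_smul, smul_add, smul_neg, smul_smul, h3]
        abel
      have hxn : ‖x‖ ^ 2 ≤ ‖a‖ ^ 2 + s ^ 2 := by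
        rw [sq, ← CStarRing.norm_star_mul_self, hs]
        refine (norm_add_le _ _).trans ?_
        gcongr
        · rw [sq]; exact norm_mul_le _ _
        · simp [norm_smul]
      have him : (θ x).im = (θ a).im + s := by simp [hx, h1]
      rw [← him, ← sq_abs]
      refine le_trans ?_ hxn
      gcongr
      exact (Complex.abs_im_le_norm _).trans (bound x)
    by_contra hne
    have hne' : (θ a).im ≠ 0 := fun h => hne (by simp [h])
    have := key ((‖a‖ ^ 2 + 1) / (2 * (θ a).im))
    have h4 : 2 * (θ a).im * ((‖a‖ ^ 2 + 1) / (2 * (θ a).im)) = ‖a‖ ^ 2 + 1 := by field_simp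
    nlinarith [sq_nonneg (θ a).im]

/-- A positive real functional on the self-adjoint part extends to a positive functional. -/
lemma exists_of_selfAdjoint (u : selfAdjoint A →ₗ[ℝ] ℝ)
    (hu : ∀ a : selfAdjoint A, 0 ≤ (a : A) → 0 ≤ u a) :
    ∃ f : A →ₚ[ℂ] ℂ, ∀ a : selfAdjoint A, f a = u a := by
  have key (a : selfAdjoint A) :
      Module.Dual.extendRCLike (𝕜 := ℂ) (u ∘ₗ realPart) (a : A) = u a := by
    rw [Module.Dual.extendRCLike_apply]
    simp [a.2.imaginaryPart]
  refine ⟨.mk₀ (Module.Dual.extendRCLike (u ∘ₗ realPart)) fun x hx => ?_, key⟩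
  have := key ⟨x, .of_nonneg hx⟩
  rw [this]
  exact_mod_cast hu _ hx

end PositiveLinearMap

/-- Hahn–Banach: a sublinear function is attained at any point by a linear minorant. -/
lemma exists_linearMap_le_sublinear_eq {E : Type*} [AddCommGroup E] [Module ℝ E] (N : E → ℝ)
    (N_hom : ∀ c : ℝ, 0 < c → ∀ x, N (c • x) = c * N x)
    (N_add : ∀ x y, N (x + y) ≤ N x + N y) (v : E) :
    ∃ g : E →ₗ[ℝ] ℝ, g v = N v ∧ ∀ x, g x ≤ N x := by
  have N_zero : N 0 = 0 := by
    have := N_hom 2 two_pos 0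
    rw [smul_zero] at this
    linarith
  by_cases hv : v = 0
  · obtain ⟨g, -, hg⟩ := exists_extension_of_le_sublinear (⊥ : E →ₗ.[ℝ] ℝ) N N_hom N_add
      (fun x => by
        obtain ⟨x, hx⟩ := x
        obtain rfl := (Submodule.mem_bot ℝ).1 hx
        have : (⟨0, hx⟩ : (⊥ : E →ₗ.[ℝ] ℝ).domain) = 0 := rfl
        rw [this, LinearPMap.map_zero]
        simp [N_zero])
    exact ⟨g, by simp [hv, N_zero], hg⟩
  · obtain ⟨g, hgv, hg⟩ := exists_extension_of_le_sublinear
      (LinearPMap.mkSpanSingleton v (N v) hv) N N_hom N_add (by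
        rintro ⟨x, hx⟩
        obtain ⟨c, rfl⟩ := Submodule.mem_span_singleton.1 hx
        rw [LinearPMap.mkSpanSingleton'_apply]
        change c • N v ≤ N (c • v)
        rcases lt_trichotomy c 0 with hc | rfl | hc
        · have h1 := N_add (c • v) (-c • v)
          rw [← add_smul, add_neg_cancel, zero_smul, N_zero, N_hom (-c) (by linarith)] at h1
          rw [smul_eq_mul]
          linarith
        · simp [N_zero]
        · rw [N_hom c hc, smul_eq_mul])
    refine ⟨g, ?_, hg⟩
    have := hgv ⟨v, Submodule.mem_span_singleton_self v⟩
    rw [this]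
    exact LinearPMap.mkSpanSingleton_apply ..

namespace PositiveLinearMap

variable {A : Type*} [CStarAlgebra A] [PartialOrder A] [StarOrderedRing A]

/-- A unital positive functional which dominates only its own multiples satisfies an
approximate form of Riesz interpolation. -/
lemma exists_selfAdjoint_upper_bound {φ : A →ₚ[ℂ] ℂ} (h1 : φ 1 = 1)
    (hφ : ∀ f g : A →ₚ[ℂ] ℂ, f + g = φ → ∀ a, f a = f 1 * φ a)
    (a b : selfAdjoint A) {m m' : ℝ} (ha : (φ a).re ≤ m) (hb : (φ b).re ≤ m) (hm : m < m') :
    ∃ c : selfAdjoint A, a ≤ c ∧ b ≤ c ∧ (φ c).re < m' := by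
  let S (v : selfAdjoint A × selfAdjoint A) : Set ℝ :=
    (fun c : selfAdjoint A => (φ c).re) '' {c | v.1 ≤ c ∧ v.2 ≤ c}
  have mono {x y : selfAdjoint A} (h : x ≤ y) : (φ x).re ≤ (φ y).re := φ.re_apply_mono h
  have S_bdd v : BddBelow (S v) := ⟨(φ v.1).re, by
    rintro _ ⟨c, hc, rfl⟩
    exact mono hc.1⟩
  have S_ne v : (S v).Nonempty := by
    have hle (x : selfAdjoint A) (r : ℝ) (hr : ‖(x : A)‖ ≤ r) : x ≤ r • (1 : selfAdjoint A) := by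
      rw [← Subtype.coe_le_coe]
      refine (IsSelfAdjoint.le_algebraMap_norm_self x.2).trans ?_
      simpa [← Algebra.algebraMap_eq_smul_one] using algebraMap_mono A hr
    exact ⟨_, _, ⟨hle v.1 (max ‖(v.1 : A)‖ ‖(v.2 : A)‖) (le_max_left _ _),
      hle v.2 _ (le_max_right _ _)⟩, rfl⟩
  have S_le {v} {c : selfAdjoint A} (h : v.1 ≤ c) (h' : v.2 ≤ c) : sInf (S v) ≤ (φ c).re :=
    csInf_le (S_bdd v) ⟨c, ⟨h, h'⟩, rfl⟩
  have smul_mono {r : ℝ} (hr : 0 ≤ r) {x y : selfAdjoint A} (h : x ≤ y) : r • x ≤ r • y :=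
    Subtype.coe_le_coe.1 (smul_le_smul_of_nonneg_left (Subtype.coe_le_coe.2 h) hr)
  have smul_le (r : ℝ) (hr : 0 < r) v : sInf (S (r • v)) ≤ r * sInf (S v) := by
    rw [← div_le_iff₀' hr]
    refine le_csInf (S_ne v) ?_
    rintro _ ⟨c, hc, rfl⟩
    rw [div_le_iff₀' hr]
    have := S_le (v := r • v) (c := r • c) (smul_mono hr.le hc.1)
      (smul_mono hr.le hc.2)
    simpa using this
  obtain ⟨g, hg, hgle⟩ := exists_linearMap_le_sublinear_eq (fun v => sInf (S v))
    (fun r hr v => le_antisymm (smul_le r hr v) (by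
      have := smul_le r⁻¹ (inv_pos.2 hr) (r • v)
      rw [inv_smul_smul₀ hr.ne'] at this
      rwa [← le_inv_mul_iff₀ hr]))
    (fun v w => by
      refine le_of_forall_pos_lt_add fun ε hε => ?_
      obtain ⟨_, ⟨c, hc, rfl⟩, hcε⟩ := Real.lt_sInf_add_pos (S_ne v) (half_pos hε)
      obtain ⟨_, ⟨d, hd, rfl⟩, hdε⟩ := Real.lt_sInf_add_pos (S_ne w) (half_pos hε)
      have := S_le (v := v + w) (add_le_add hc.1 hd.1) (add_le_add hc.2 hd.2)
      simp only [AddSubgroup.coe_add, map_add, Complex.add_re] at this hcε hdε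
      linarith) (a, b)
  have g_nonneg (v : selfAdjoint A × selfAdjoint A) (h : 0 ≤ v) : 0 ≤ g v := by
    have h' := (hgle (-v)).trans (S_le (v := -v) (c := 0) (neg_nonpos.2 h.1) (neg_nonpos.2 h.2))
    simpa using h'
  have g_diag (x : selfAdjoint A) : g (x, x) = (φ x).re := by
    have hle (x : selfAdjoint A) : g (x, x) ≤ (φ x).re := (hgle _).trans (S_le le_rfl le_rfl)
    refine le_antisymm (hle x) ?_
    have := hle (-x)
    rw [← Prod.neg_mk, map_neg] at this
    simpa using this
  obtain ⟨f₁, hf₁⟩ := exists_of_selfAdjoint (g ∘ₗ LinearMap.inl ℝ _ _)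
    (fun x hx => g_nonneg _ ⟨hx, le_rfl⟩)
  obtain ⟨f₂, hf₂⟩ := exists_of_selfAdjoint (g ∘ₗ LinearMap.inr ℝ _ _)
    (fun x hx => g_nonneg _ ⟨le_rfl, hx⟩)
  have hsum : f₁ + f₂ = φ := by
    have key (x : selfAdjoint A) : f₁ x + f₂ x = φ x := by
      rw [hf₁, hf₂, ← φ.ofReal_re_apply x.2, ← g_diag, ← Complex.ofReal_add]
      simp [← map_add]
    ext x
    rw [← realPart_add_I_smul_imaginaryPart x]
    simp only [add_apply, map_add, map_smul, ← key, smul_eq_mul]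
  have hsum' : f₂ + f₁ = φ := by rw [add_comm, hsum]
  have hf1 : f₁ 1 + f₂ 1 = 1 := by rw [← h1, ← hsum, add_apply]
  have e₁ := hφ f₁ f₂ hsum a
  have e₂ := hφ f₂ f₁ hsum' b
  have p₁ := f₁.map_nonneg (zero_le_one (α := A))
  have p₂ := f₂.map_nonneg (zero_le_one (α := A))
  have hval : sInf (S (a, b)) = (f₁ a).re + (f₂ b).re := by
    rw [hf₁, hf₂, ← hg]
    simp [← map_add]
  have hlt : sInf (S (a, b)) < m' := by
    rw [Complex.le_def] at p₁ p₂
    rw [hval, e₁, e₂, Complex.mul_re, Complex.mul_re, ← p₁.2, ← p₂.2]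
    have := congrArg Complex.re hf1
    simp only [Complex.add_re, Complex.one_re, Complex.zero_re, Complex.zero_im] at *
    have hm' : (f₁ 1).re * m + (f₂ 1).re * m = m := by rw [← add_mul, this, one_mul]
    linarith [mul_le_mul_of_nonneg_left ha p₁.1, mul_le_mul_of_nonneg_left hb p₂.1]
  obtain ⟨_, ⟨c, hc, rfl⟩, hlt⟩ := exists_lt_of_csInf_lt (S_ne _) hlt
  exact ⟨c, hc.1, hc.2, hlt⟩

lemma exists_norm_le_one_of_upper_bound (x : A) {c : A} (hc1 : 1 ≤ c)
    (hxc : star x * x ≤ c) :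
    ∃ y : A, ‖y‖ ≤ 1 ∧ star (x - y) * (x - y) ≤ c - 1 := by
  have hc0 : 0 ≤ c := zero_le_one.trans hc1
  set s := CFC.sqrt c with hs
  have hss : s * s = c := CFC.sqrt_mul_sqrt_self c
  have hs0 : 0 ≤ s := CFC.sqrt_nonneg c
  have hs1 : 1 ≤ s := by
    simpa using CFC.sqrt_le_sqrt 1 c hc1
  obtain ⟨u, hu⟩ := CStarAlgebra.isUnit_of_le 1 hs1
  set k : A := ↑u⁻¹ with hk
  have hks : k * s = 1 := by rw [← hu, hk, Units.inv_mul]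
  have hsk : s * k = 1 := by rw [← hu, hk, Units.mul_inv]
  have hk0 : star k = k := by
    have h : star k * s = 1 := by
      simpa [(IsSelfAdjoint.of_nonneg hs0).star_eq] using congrArg star hsk
    calc star k = star k * (s * k) := by rw [hsk, mul_one]
      _ = k := by rw [← mul_assoc, h, one_mul]
  refine ⟨x * k, ?_, ?_⟩
  · have h : star (x * k) * (x * k) ≤ 1 := by
      have := star_left_conjugate_le_conjugate hxc k
      calc star (x * k) * (x * k) = star k * (star x * x) * k := by simp [mul_assoc]
        _ ≤ star k * c * k := this
        _ = (k * s) * (s * k) := by rw [hk0, ← hss]; simp only [mul_assoc]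
        _ = 1 := by rw [hks, hsk, one_mul]
    rw [← CStarAlgebra.norm_le_one_iff_of_nonneg _ (star_mul_self_nonneg _),
      CStarRing.norm_star_mul_self] at h
    nlinarith [norm_nonneg (x * k)]
  · have := star_left_conjugate_le_conjugate hxc (1 - k)
    calc star (x - x * k) * (x - x * k) = star (1 - k) * (star x * x) * (1 - k) := by
          simp only [star_sub, star_mul, star_one, mul_sub, sub_mul, mul_one, one_mul, mul_assoc]
      _ ≤ star (1 - k) * c * (1 - k) := this
      _ = c - s * (s * k) - k * s * s + (k * s) * (s * k) := by
          simp only [← hss, star_sub, star_one, hk0, mul_sub, sub_mul, mul_one, one_mul, mul_assoc]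
          abel
      _ = c - 1 - 2 • (s - 1) := by
          rw [hks, hsk]; simp only [mul_one, one_mul]; abel
      _ ≤ c - 1 := sub_le_self _ (nsmul_nonneg (sub_nonneg.2 hs1) 2)

lemma exists_norm_le_approx {φ : A →ₚ[ℂ] ℂ} (h1 : φ 1 = 1)
    (hφ : ∀ f g : A →ₚ[ℂ] ℂ, f + g = φ → ∀ a, f a = f 1 * φ a)
    (x : A) {r ε : ℝ} (hr : 0 < r) (hε : 0 < ε) (hx : (φ (star x * x)).re ≤ r ^ 2) :
    ∃ y : A, ‖y‖ ≤ r ∧ (φ (star (x - y) * (x - y))).re ≤ ε := by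
  have hx' : (φ (star (r⁻¹ • x) * (r⁻¹ • x))).re ≤ 1 := by
    rw [re_apply_star_mul_self_real_smul, inv_pow, inv_mul_le_iff₀ (by positivity), mul_one]
    exact hx
  obtain ⟨c, hc, hc1, hlt⟩ := exists_selfAdjoint_upper_bound h1 hφ
    ⟨_, IsSelfAdjoint.star_mul_self (r⁻¹ • x)⟩ 1 hx' (by simp [h1])
    (lt_add_of_pos_right 1 (show 0 < ε / r ^ 2 by positivity))
  obtain ⟨y, hy, hxy⟩ := exists_norm_le_one_of_upper_bound (r⁻¹ • x) (c := c) hc1 hc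
  refine ⟨r • y, ?_, ?_⟩
  · rw [norm_smul, Real.norm_of_nonneg hr.le]
    exact mul_le_of_le_one_right hr.le hy
  · have h2 : x - r • y = r • (r⁻¹ • x - y) := by rw [smul_sub, smul_inv_smul₀ hr.ne']
    have h3 := φ.re_apply_mono hxy
    rw [map_sub, h1, Complex.sub_re, Complex.one_re] at h3
    rw [h2, re_apply_star_mul_self_real_smul, ← le_div_iff₀' (by positivity)]
    linarith

/-- Every element of the closed unit ball of the GNS seminorm of a pure state has a representative
of norm at most two. -/
lemma exists_norm_le_two {φ : A →ₚ[ℂ] ℂ} (h1 : φ 1 = 1)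
    (hφ : ∀ f g : A →ₚ[ℂ] ℂ, f + g = φ → ∀ a, f a = f 1 * φ a)
    (x : A) (hx : (φ (star x * x)).re ≤ 1) :
    ∃ y : A, ‖y‖ ≤ 2 ∧ φ (star (x - y) * (x - y)) = 0 := by
  have step (n : ℕ) (z : A) : ∃ w : A, (φ (star z * z)).re ≤ ((1 / 2 : ℝ) ^ n) ^ 2 →
      ‖z - w‖ ≤ (1 / 2) ^ n ∧ (φ (star w * w)).re ≤ ((1 / 2 : ℝ) ^ (n + 1)) ^ 2 := by
    by_cases hz : (φ (star z * z)).re ≤ ((1 / 2 : ℝ) ^ n) ^ 2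
    · obtain ⟨y, hy, hy'⟩ := exists_norm_le_approx h1 hφ z (by positivity)
        (show 0 < ((1 / 2 : ℝ) ^ (n + 1)) ^ 2 by positivity) hz
      exact ⟨z - y, fun _ => ⟨by simpa using hy, hy'⟩⟩
    · exact ⟨0, fun h => absurd h hz⟩
  choose w hw using step
  let u : ℕ → A := fun n => Nat.rec x w n
  have hu (n : ℕ) : (φ (star (u n) * u n)).re ≤ ((1 / 2 : ℝ) ^ n) ^ 2 := by
    induction n with
    | zero => simpa [u] using hx
    | succ n ih => exact (hw n (u n) ih).2
  have hdist (n : ℕ) : dist (u n) (u (n + 1)) ≤ 2 / 2 / 2 ^ n := by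
    rw [dist_eq_norm]
    exact (hw n (u n) (hu n)).1.trans_eq (by simp)
  obtain ⟨z, hz⟩ := cauchySeq_tendsto_of_complete (cauchySeq_of_le_geometric_two hdist)
  refine ⟨x - z, ?_, ?_⟩
  · rw [← dist_eq_norm]
    exact dist_le_of_le_geometric_two_of_tendsto₀ hdist hz
  · rw [sub_sub_cancel, ← φ.ofReal_re_apply (.star_mul_self z), Complex.ofReal_eq_zero]
    have hc : Continuous φ := map_continuous φ
    have lim₁ : Tendsto (fun n => (φ (star (u n) * u n)).re) atTop (nhds (φ (star z * z)).re) :=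
      (Complex.continuous_re.tendsto _).comp ((hc.tendsto _).comp (hz.star.mul hz))
    have lim₂ : Tendsto (fun n : ℕ => ((1 / 2 : ℝ) ^ n) ^ 2) atTop (nhds 0) := by
      simpa using (tendsto_pow_atTop_nhds_zero_of_lt_one (r := (1 / 2 : ℝ)) (by norm_num)
        (by norm_num)).pow 2
    exact le_antisymm (le_of_tendsto_of_tendsto' lim₁ lim₂ hu)
      (Complex.le_def.1 (φ.map_nonneg (star_mul_self_nonneg z))).1

/-- A pure state is determined by its left kernel among all states. -/
lemma eq_of_leftKernel_le {φ : A →ₚ[ℂ] ℂ} (h1 : φ 1 = 1)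
    (hφ : ∀ f g : A →ₚ[ℂ] ℂ, f + g = φ → ∀ a, f a = f 1 * φ a)
    {θ : A →ₚ[ℂ] ℂ} (hθ1 : θ 1 = 1)
    (hθ : ∀ a, φ (star a * a) = 0 → θ (star a * a) = 0) : θ = φ := by
  have unit_bound (x : A) (hx : (φ (star x * x)).re ≤ 1) : (θ (star x * x)).re ≤ 4 := by
    obtain ⟨y, hy, hxy⟩ := exists_norm_le_two h1 hφ x hx
    rw [θ.apply_star_mul_self_congr (hθ _ hxy)]
    refine (θ.re_apply_star_mul_self_le y).trans ?_
    rw [hθ1, Complex.one_re]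
    nlinarith [norm_nonneg y]
  have bound (x : A) : (θ (star x * x)).re ≤ 4 * (φ (star x * x)).re := by
    have h0 : 0 ≤ (φ (star x * x)).re :=
      (Complex.le_def.1 (φ.map_nonneg (star_mul_self_nonneg x))).1
    rcases h0.eq_or_lt with h | h
    · rw [hθ x (by rw [← φ.ofReal_re_apply (.star_mul_self x), ← h, Complex.ofReal_zero]), ← h]
      simp
    · have ht : (√(φ (star x * x)).re)⁻¹ ^ 2 = (φ (star x * x)).re⁻¹ := by
        rw [inv_pow, Real.sq_sqrt h0]
      have h2 := unit_bound ((√(φ (star x * x)).re)⁻¹ • x) (by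
        rw [re_apply_star_mul_self_real_smul, ht, inv_mul_cancel₀ h.ne'])
      rw [re_apply_star_mul_self_real_smul, ht, inv_mul_le_iff₀ h] at h2
      linarith
  let f : A →ₚ[ℂ] ℂ := .mk₀ ((1 / 4 : ℂ) • θ.toLinearMap) fun x hx =>
    mul_nonneg (by norm_num [Complex.le_def]) (θ.map_nonneg hx)
  let g : A →ₚ[ℂ] ℂ := .mk₀ (φ.toLinearMap - (1 / 4 : ℂ) • θ.toLinearMap) fun x hx => by
    obtain ⟨y, rfl⟩ := CStarAlgebra.nonneg_iff_eq_star_mul_self.1 hx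
    have := bound y
    change 0 ≤ φ _ - (1 / 4 : ℂ) * θ _
    rw [← φ.ofReal_re_apply (.star_mul_self y), ← θ.ofReal_re_apply (.star_mul_self y)]
    have h4 : (1 / 4 : ℂ) = ((1 / 4 : ℝ) : ℂ) := by norm_num
    rw [h4]
    norm_cast
    linarith
  have hfg : f + g = φ := by
    ext x
    change (1 / 4 : ℂ) * θ x + (φ x - (1 / 4 : ℂ) * θ x) = φ x
    ring
  ext x
  have h : (1 / 4 : ℂ) * θ x = (1 / 4 : ℂ) * θ 1 * φ x := hφ f g hfg x
  rw [hθ1] at h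
  linear_combination 4 * h

end PositiveLinearMap

section PureState

variable {A : Type*} [CStarAlgebra A] [PartialOrder A] [StarOrderedRing A]

lemma IsState.apply_nonneg {φ : A →L[ℂ] ℂ} (hφ : IsState A φ) {a : A} (ha : 0 ≤ a) :
    0 ≤ φ a := by
  obtain ⟨b, rfl⟩ := CStarAlgebra.nonneg_iff_eq_star_mul_self.1 ha
  obtain ⟨r, hr, h⟩ := hφ.2 b
  rw [h]
  exact_mod_cast hr

lemma IsState.apply_one [Nontrivial A] {φ : A →L[ℂ] ℂ} (hφ : IsState A φ) : φ 1 = 1 := by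
  let f : A →ₚ[ℂ] ℂ := .mk₀ φ.toLinearMap fun _ => hφ.apply_nonneg
  have h0 : 0 ≤ f 1 := f.map_nonneg zero_le_one
  rw [Complex.le_def] at h0
  have hle : ‖φ‖ ≤ (f 1).re := φ.opNorm_le_bound h0.1 f.norm_apply_le
  have hge : ‖φ 1‖ ≤ 1 := by simpa [hφ.1] using φ.le_opNorm 1
  rw [hφ.1] at hle
  refine Complex.ext (le_antisymm ((Complex.re_le_norm _).trans hge) hle) h0.2.symm

lemma PositiveLinearMap.isState_inv_smul [Nontrivial A] (f : A →ₚ[ℂ] ℂ) {t : ℝ} (ht : 0 < t)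
    (h1 : f 1 = t) : IsState A (t⁻¹ • (⟨f.toLinearMap, map_continuous f⟩ : A →L[ℂ] ℂ)) := by
  have happ (a : A) :
      (t⁻¹ • (⟨f.toLinearMap, map_continuous f⟩ : A →L[ℂ] ℂ)) a = t⁻¹ • f a := rfl
  refine ⟨le_antisymm (ContinuousLinearMap.opNorm_le_bound _ zero_le_one fun a => ?_) ?_,
    fun a => ⟨t⁻¹ * (f (star a * a)).re, ?_, ?_⟩⟩
  · have := f.norm_apply_le a
    rw [h1, Complex.ofReal_re] at this
    rw [happ, norm_smul, norm_inv, Real.norm_of_nonneg ht.le, inv_mul_le_iff₀ ht, one_mul]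
    exact this
  · have := (t⁻¹ • (⟨f.toLinearMap, map_continuous f⟩ : A →L[ℂ] ℂ)).le_opNorm 1
    rw [happ, h1, norm_one, mul_one] at this
    simpa [ht.ne', abs_of_pos ht] using this
  · exact mul_nonneg (inv_nonneg.2 ht.le)
      (Complex.le_def.1 (f.map_nonneg (star_mul_self_nonneg a))).1
  · rw [happ, ← f.ofReal_re_apply (.star_mul_self a)]
    simp

/-- The positive functionals dominated by a pure state are its multiples. -/
lemma IsPureState.apply_eq_of_add_eq [Nontrivial A] {φ : A →L[ℂ] ℂ} (hφ : IsPureState A φ)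
    {f g : A →ₚ[ℂ] ℂ} (hfg : ∀ a, f a + g a = φ a) (a : A) : f a = f 1 * φ a := by
  have hf := f.ofReal_re_apply (.one A)
  have hg := g.ofReal_re_apply (.one A)
  have hf0 := (Complex.le_def.1 (f.map_nonneg (zero_le_one (α := A)))).1
  have hg0 := (Complex.le_def.1 (g.map_nonneg (zero_le_one (α := A)))).1
  have hsum : (f 1).re + (g 1).re = 1 := by
    rw [← Complex.add_re, hfg, hφ.1.apply_one, Complex.one_re]
  rcases hf0.eq_or_lt with h | hfpos
  · have := f.norm_apply_le a
    rw [← h, Complex.zero_re, zero_mul, norm_le_zero_iff] at this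
    rw [this, ← hf, ← h]
    simp
  rcases hg0.eq_or_lt with h | hgpos
  · have := g.norm_apply_le a
    rw [← h, Complex.zero_re, zero_mul, norm_le_zero_iff] at this
    rw [← hfg, this, ← hf, eq_sub_of_add_eq hsum, ← h]
    simp
  have key := (mem_extremePoints_iff_left.1 hφ).2 _ (f.isState_inv_smul hfpos hf.symm) _
    (g.isState_inv_smul hgpos hg.symm) ⟨_, _, hfpos, hgpos, hsum, by
      rw [smul_inv_smul₀ hfpos.ne', smul_inv_smul₀ hgpos.ne']
      exact ContinuousLinearMap.ext hfg⟩
  rw [← key, ← hf]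
  change _ = ((f 1).re : ℂ) * ((f 1).re⁻¹ • f a)
  rw [Complex.real_smul, ← mul_assoc, ← Complex.ofReal_mul, mul_inv_cancel₀ hfpos.ne']
  simp

lemma CStarAlgebra.norm_one_sub_two_smul_le {a : A} (ha : 0 ≤ a) (ha1 : a ≤ 1) :
    ‖1 - (2 : ℂ) • a‖ ≤ 1 := by
  have hsa : star a = a := (IsSelfAdjoint.of_nonneg ha).star_eq
  have hsq : a ^ 2 ≤ a := by simpa using CStarAlgebra.pow_antitone ha ha1 one_le_two
  have h : star (1 - (2 : ℂ) • a) * (1 - (2 : ℂ) • a) ≤ 1 := by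
    have : star (1 - (2 : ℂ) • a) * (1 - (2 : ℂ) • a) = 1 - 4 • (a - a ^ 2) := by
      have h2 : (2 : ℂ) • a = 2 * a := by rw [two_smul, two_mul]
      have h2' : star (2 : A) = 2 := star_ofNat 2
      rw [h2, star_sub, star_mul, hsa, star_one, h2']
      noncomm_ring
    rw [this]
    exact sub_le_self _ (nsmul_nonneg (sub_nonneg.2 hsq) 4)
  rw [← CStarAlgebra.norm_le_one_iff_of_nonneg _ (star_mul_self_nonneg _),
    CStarRing.norm_star_mul_self] at h
  nlinarith [norm_nonneg (1 - (2 : ℂ) • a)]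

lemma ContinuousLinearMap.tendsto_apply_zero_of_tendsto_one_sub [Nontrivial A] {ι : Type*}
    {l : Filter ι} {e : ι → A} (he : ∀ n, 0 ≤ e n) (he1 : ∀ n, e n ≤ 1)
    {θ : A →L[ℂ] ℂ} (hθ : ‖θ‖ ≤ 1) (hlim : Tendsto (fun n => θ (1 - e n)) l (nhds 1)) :
    Tendsto (fun n => θ (e n)) l (nhds 0) := by
  have bound (x : A) (hx : ‖x‖ ≤ 1) : ‖θ x‖ ≤ 1 :=
    (θ.le_of_opNorm_le hθ x).trans (by simpa using hx)
  have hle (n : ι) : ‖θ (e n)‖ ^ 2 ≤ 1 - ‖θ (1 - e n)‖ ^ 2 := by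
    have h := parallelogram_law_with_norm ℂ (θ (1 - e n)) (θ (e n))
    have h₁ := bound 1 norm_one.le
    have h₂ := bound _ (CStarAlgebra.norm_one_sub_two_smul_le (he n) (he1 n))
    have e₁ : θ (1 - e n) + θ (e n) = θ 1 := by rw [← map_add, sub_add_cancel]
    have e₂ : θ (1 - e n) - θ (e n) = θ (1 - (2 : ℂ) • e n) := by
      rw [← map_sub, two_smul, sub_sub]
    rw [e₁, e₂] at h
    nlinarith [norm_nonneg (θ 1), norm_nonneg (θ (1 - (2 : ℂ) • e n))]
  have hzero : Tendsto (fun n => 1 - ‖θ (1 - e n)‖ ^ 2) l (nhds 0) := by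
    simpa using (hlim.norm.pow 2).const_sub 1
  have hsq := squeeze_zero (fun n => sq_nonneg ‖θ (e n)‖) hle hzero
  rw [tendsto_zero_iff_norm_tendsto_zero]
  simpa using hsq.sqrt

end PureState


/-- Let `φ` be a pure state on a unital complex C*-algebra `A`,
`L = {a : φ (a* a) = 0}` the associated left ideal and `(e n)` an approximate unit for the
hereditary subalgebra `L ∩ L*`. Then any bounded linear functional `θ` with `‖θ‖ ≤ 1` and
`lim θ (1 - e n) = 1` coincides with `φ`. -/
theorem eq_pureState_of_tendsto_one
    (A : Type*) [CStarAlgebra A] (φ : A →L[ℂ] ℂ) (hφ : IsPureState A φ)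
    (ι : Type*) [Preorder ι] [IsDirected ι (· ≤ ·)] [Nonempty ι]
    (e : ι → A)
    (hpos : ∀ n, ∃ b : A, e n = star b * b)
    (hnorm : ∀ n, ‖e n‖ ≤ 1)
    (hmem : ∀ n, φ (star (e n) * e n) = 0 ∧ φ (e n * star (e n)) = 0)
    (happrox : ∀ b : A, φ (star b * b) = 0 → φ (b * star b) = 0 →
      Tendsto (fun n => ‖e n * b - b‖) atTop (nhds 0) ∧
      Tendsto (fun n => ‖b * e n - b‖) atTop (nhds 0))
    (θ : A →L[ℂ] ℂ) (hθ : ‖θ‖ ≤ 1)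
    (hlim : Tendsto (fun n => θ (1 - e n)) atTop (nhds (1 : ℂ))) :
    θ = φ := by
  have : Nontrivial A := by
    by_contra h
    rw [not_nontrivial_iff_subsingleton] at h
    have h0 : φ = 0 := ContinuousLinearMap.ext fun a => by simp [Subsingleton.elim a 0]
    simpa [h0] using hφ.1.1
  let _ := CStarAlgebra.spectralOrder A
  have := CStarAlgebra.spectralOrderedRing A
  have he (n : ι) : 0 ≤ e n := by
    obtain ⟨b, hb⟩ := hpos n
    exact hb ▸ star_mul_self_nonneg b
  have he1 (n : ι) : e n ≤ 1 := (CStarAlgebra.norm_le_one_iff_of_nonneg _ (he n)).1 (hnorm n)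
  have hθe := ContinuousLinearMap.tendsto_apply_zero_of_tendsto_one_sub he he1 hθ hlim
  have hθ1 : θ 1 = 1 := by
    have h := hlim.add hθe
    simp only [← map_add, sub_add_cancel, add_zero] at h
    exact tendsto_nhds_unique tendsto_const_nhds h
  let Φ : A →ₚ[ℂ] ℂ := .mk₀ φ.toLinearMap fun _ => hφ.1.apply_nonneg
  let Θ : A →ₚ[ℂ] ℂ := .mk₀ θ.toLinearMap fun _ => θ.apply_nonneg_of_norm_le_one hθ hθ1
  have hΘe : Tendsto (fun n => (Θ (e n)).re) atTop (nhds 0) :=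
    (Complex.continuous_re.tendsto _).comp hθe
  have hΘ (a : A) (ha : Φ (star a * a) = 0) : Θ (star a * a) = 0 := by
    set b := star a * a with hb
    have hbs : star b = b := (IsSelfAdjoint.star_mul_self a).star_eq
    have hbb : Φ (star b * b) = 0 := by
      have hle : star b * b ≤ ‖a * star a‖ • b := by
        rw [hbs, hb]
        simpa [mul_assoc] using CStarAlgebra.star_left_conjugate_le_norm_smul (a := a)
          (b := a * star a) (.mul_star_self a)
      refine le_antisymm ((OrderHomClass.mono Φ hle).trans_eq ?_)
        (Φ.map_nonneg (star_mul_self_nonneg b))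
      rw [Φ.map_smul_of_tower, ha, smul_zero]
    have heb : Tendsto (fun n => e n * b) atTop (nhds b) :=
      tendsto_iff_norm_sub_tendsto_zero.2 (happrox b hbb (by rw [hbs] at hbb ⊢; exact hbb)).1
    have hcs (n : ι) : ‖Θ (e n * b)‖ ^ 2 ≤ (Θ (e n)).re * (Θ (star b * b)).re := by
      have h := Θ.norm_apply_star_mul_sq_le (e n) b
      rw [(IsSelfAdjoint.of_nonneg (he n)).star_eq] at h
      refine h.trans (mul_le_mul_of_nonneg_right (Θ.re_apply_mono ?_)
        (Complex.le_def.1 (Θ.map_nonneg (star_mul_self_nonneg b))).1)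
      simpa [sq] using CStarAlgebra.pow_antitone (he n) (he1 n) one_le_two
    have hlim₁ : Tendsto (fun n => ‖Θ (e n * b)‖ ^ 2) atTop (nhds (‖Θ b‖ ^ 2)) :=
      ((θ.continuous.tendsto b).comp heb).norm.pow 2
    have hlim₂ := hΘe.mul_const (Θ (star b * b)).re
    rw [zero_mul] at hlim₂
    have := le_of_tendsto_of_tendsto' hlim₁ hlim₂ hcs
    exact norm_eq_zero.1 (pow_eq_zero_iff two_ne_zero |>.1 (le_antisymm this (sq_nonneg _)))
  have hΦ (f g : A →ₚ[ℂ] ℂ) (hfg : f + g = Φ) (a : A) : f a = f 1 * Φ a :=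
    hφ.apply_eq_of_add_eq (fun x => congrArg (fun F : A →ₚ[ℂ] ℂ => F x) hfg) a
  have h := PositiveLinearMap.eq_of_leftKernel_le (φ := Φ) hφ.1.apply_one hΦ (θ := Θ) hθ1 hΘ
  exact ContinuousLinearMap.ext fun a => congrArg (fun F : A →ₚ[ℂ] ℂ => F a) h
end

section
/- Let A be a unital complex C*-algebra and E ⊂ S_A a maximal face of the unit sphere. Then E coincides with the closed convex hull of the set of unitary elements contained in E. -/
variable {X : Type*} [NormedAddCommGroup X] [NormedSpace ℝ X]

open Metric

namespace IsMaximalFace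

variable {E : Set X}

/-- A point of the unit ball that is at distance two from `-E`, for a maximal face `E`,
belongs to `E`. -/
lemma mem_of_two_le_norm_add (hE : IsMaximalFace E) {y : X} (hy : ‖y‖ ≤ 1)
    (h : ∀ e ∈ E, 2 ≤ ‖e + y‖) : y ∈ E := by
  obtain ⟨⟨⟨e₀, he₀⟩, hconv, hext⟩, -, hmax⟩ := hE
  have hdisj : Disjoint (ball (0 : X) 2) ((fun z ↦ z + y) '' E) := by
    rw [Set.disjoint_right]
    rintro _ ⟨e, he, rfl⟩ hmem
    exact (mem_ball_zero_iff.1 hmem).not_ge (h e he)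
  have hconv' : Convex ℝ ((fun z ↦ z + y) '' E) := by
    simpa only [add_comm] using hconv.translate y
  obtain ⟨f, u, hf, hu⟩ :=
    geometric_hahn_banach_open (convex_ball (0 : X) 2) isOpen_ball hconv' hdisj
  have hu_pos : 0 < u := by simpa using hf 0 (by simp)
  have hle : ∀ z ∈ closedBall (0 : X) 1, f z ≤ u / 2 := by
    intro z hz
    have hz2 : (2 : ℝ) • z ∈ closure (ball (0 : X) 2) := by
      rw [closure_ball _ two_ne_zero, mem_closedBall_zero_iff, norm_smul]
      have := mem_closedBall_zero_iff.1 hz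
      norm_num
      linarith
    have : f ((2 : ℝ) • z) ≤ u :=
      closure_minimal (fun w hw ↦ (hf w hw).le) (isClosed_le f.continuous continuous_const) hz2
    rw [map_smul, smul_eq_mul] at this
    linarith
  have hy' : y ∈ closedBall (0 : X) 1 := by simpa using hy
  have heq : ∀ e ∈ E, f e = u / 2 ∧ f y = u / 2 := by
    intro e he
    have h₁ := hu _ ⟨e, he, rfl⟩
    have h₂ := hle e (hext.subset he)
    have h₃ := hle y hy'
    simp only [map_add] at h₁
    constructor <;> linarith
  have hface : IsFace (closedBall (0 : X) 1 ∩ {z | f z = u / 2}) := by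
    refine ⟨⟨e₀, hext.subset he₀, (heq e₀ he₀).1⟩,
      (convex_closedBall _ _).inter (convex_hyperplane f.isLinear _), Set.inter_subset_left, ?_⟩
    rintro a ha b hb _ ⟨-, hz⟩ ⟨s, t, hs, ht, hst, rfl⟩
    refine ⟨ha, ?_⟩
    simp only [Set.mem_ofPred_eq, map_add, map_smul, smul_eq_mul] at hz ⊢
    have h₁ := hle a ha
    have h₂ := hle b hb
    have h₃ : t * f b ≤ t * (u / 2) := by gcongr
    have h₄ : s * (u / 2) ≤ s * f a := by
      have : s * (u / 2) + t * (u / 2) = u / 2 := by rw [← add_mul, hst, one_mul]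
      linarith
    exact h₁.antisymm (le_of_mul_le_mul_left h₄ hs)
  have hne : closedBall (0 : X) 1 ∩ {z | f z = u / 2} ≠ closedBall (0 : X) 1 := by
    intro hcontra
    have h0 : (0 : X) ∈ closedBall (0 : X) 1 ∩ {z | f z = u / 2} := by simp [hcontra]
    have := h0.2
    simp only [Set.mem_ofPred_eq, map_zero] at this
    linarith
  rw [hmax _ hface hne fun e he ↦ ⟨hext.subset he, (heq e he).1⟩]
  exact ⟨hy', (heq e₀ he₀).2⟩

lemma norm_eq_one (hE : IsMaximalFace E) {x : X} (hx : x ∈ E) : ‖x‖ = 1 :=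
  mem_sphere_zero_iff_norm.1 (hE.2.1 hx)

lemma isClosed (hE : IsMaximalFace E) : IsClosed E := by
  refine isClosed_of_closure_subset fun y hy ↦ hE.mem_of_two_le_norm_add ?_ fun e he ↦ ?_
  · exact closure_minimal (fun z hz ↦ (hE.norm_eq_one hz).le)
      (isClosed_le continuous_norm continuous_const) hy
  · refine closure_minimal (fun z hz ↦ ?_)
      (isClosed_le continuous_const (continuous_const.add continuous_id).norm) hy
    have hmid := hE.norm_eq_one <|
      hE.1.2.1 he hz (by norm_num : (0 : ℝ) ≤ 1 / 2) (by norm_num : (0 : ℝ) ≤ 1 / 2) (by norm_num)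
    rw [← smul_add, norm_smul] at hmid
    norm_num at hmid
    change 2 ≤ ‖e + z‖
    linarith

end IsMaximalFace

section CStarAlgebra

variable {A : Type*} [CStarAlgebra A]

lemma mul_aeval_star_mul_self (x : A) (p : Polynomial ℝ) :
    x * Polynomial.aeval (star x * x) p = Polynomial.aeval (x * star x) p * x := by
  have hpow (n : ℕ) : x * (star x * x) ^ n = (x * star x) ^ n * x := by
    induction n with
    | zero => simp
    | succ n ih => rw [pow_succ, ← mul_assoc, ih, pow_succ]; simp only [mul_assoc]
  induction p using Polynomial.induction_on' with
  | add p q hp hq => simp only [map_add, mul_add, add_mul, hp, hq]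
  | monomial n r =>
    rw [Polynomial.aeval_monomial, Polynomial.aeval_monomial, ← mul_assoc,
      ← Algebra.commutes r x, mul_assoc, hpow, mul_assoc]

/-- The continuous functional calculi of `x* x` and `x x*` are intertwined by `x`. -/
lemma mul_cfc_star_mul_self (x : A) {f : ℝ → ℝ} (hf : Continuous f) :
    x * cfc f (star x * x) = cfc f (x * star x) * x := by
  have hnorm : ∀ a : A, ‖a‖ ≤ ‖x‖ * ‖x‖ → IsSelfAdjoint a → ∀ ε > 0, ∀ p : Polynomial ℝ,
      (∀ t ∈ Set.Icc (-(‖x‖ * ‖x‖)) (‖x‖ * ‖x‖), |p.eval t - f t| < ε) →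
      ‖cfc f a - Polynomial.aeval a p‖ ≤ ε := by
    intro a ha hsa ε hε p hp
    rw [← cfc_polynomial p a, ← cfc_sub f p.eval a]
    refine norm_cfc_le hε.le fun t ht ↦ ?_
    rw [Real.norm_eq_abs, abs_sub_comm]
    obtain (_ | _) := subsingleton_or_nontrivial A
    · simp at ht
    exact (hp t (abs_le.1 ((spectrum.norm_le_norm_of_mem ht).trans ha))).le
  rw [← sub_eq_zero, ← norm_le_zero_iff]
  refine le_of_forall_pos_le_add fun δ hδ ↦ ?_
  set ε := δ / (2 * (‖x‖ + 1)) with hε_def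
  have hε : 0 < ε := by positivity
  obtain ⟨p, hp⟩ := exists_polynomial_near_of_continuousOn (-(‖x‖ * ‖x‖)) (‖x‖ * ‖x‖) f
    hf.continuousOn ε hε
  have h₁ := hnorm (star x * x) CStarRing.norm_star_mul_self.le (.star_mul_self x) ε hε p hp
  have h₂ := hnorm (x * star x) CStarRing.norm_self_mul_star.le (.mul_star_self x) ε hε p hp
  have heq : x * cfc f (star x * x) - cfc f (x * star x) * x =
      x * (cfc f (star x * x) - Polynomial.aeval (star x * x) p) -
        (cfc f (x * star x) - Polynomial.aeval (x * star x) p) * x := by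
    rw [mul_sub, sub_mul, mul_aeval_star_mul_self]
    abel
  calc _ ≤ ‖x‖ * ε + ε * ‖x‖ := by
        rw [heq]
        exact (norm_sub_le _ _).trans (add_le_add
          ((norm_mul_le _ _).trans (by gcongr)) ((norm_mul_le _ _).trans (by gcongr)))
    _ ≤ ε * (2 * (‖x‖ + 1)) := by linarith
    _ = 0 + δ := by rw [hε_def]; field_simp; ring

/-- Existence of the defect operators `√(1 - x* x)` and `√(1 - x x*)` of a contraction. -/
lemma exists_defect {x : A} (hx : ‖x‖ ≤ 1) :
    ∃ D D' : A, IsSelfAdjoint D ∧ IsSelfAdjoint D' ∧ D * D = 1 - star x * x ∧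
      D' * D' = 1 - x * star x ∧ x * D = D' * x := by
  have hf : Continuous fun t : ℝ ↦ √(1 - t) := by fun_prop
  have hsq : ∀ a : A, IsSelfAdjoint a → ‖a‖ ≤ 1 →
      cfc (fun t : ℝ ↦ √(1 - t)) a * cfc (fun t : ℝ ↦ √(1 - t)) a = 1 - a := by
    intro a ha hna
    obtain (_ | _) := subsingleton_or_nontrivial A
    · exact Subsingleton.elim _ _
    rw [← cfc_mul _ _ a, ← cfc_id' ℝ a, ← cfc_const_one ℝ a, ← cfc_sub _ _ a, cfc_id' ℝ a]
    refine cfc_congr fun t ht ↦ Real.mul_self_sqrt ?_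
    have := (le_abs_self t).trans ((spectrum.norm_le_norm_of_mem ht).trans hna)
    linarith
  have hxx : ‖x‖ * ‖x‖ ≤ 1 := mul_le_one₀ hx (norm_nonneg _) hx
  exact ⟨_, _, IsSelfAdjoint.cfc, IsSelfAdjoint.cfc,
    hsq _ (.star_mul_self x) (CStarRing.norm_star_mul_self.le.trans hxx),
    hsq _ (.mul_star_self x) (CStarRing.norm_self_mul_star.le.trans hxx),
    mul_cfc_star_mul_self x hf⟩

open CStarAlgebra in
lemma norm_add_defect_mul_le_one [PartialOrder A] [StarOrderedRing A] {x D D' b : A}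
    (hD : IsSelfAdjoint D) (hD' : IsSelfAdjoint D') (hDD : D * D = 1 - star x * x)
    (hDD' : D' * D' = 1 - x * star x) (hxD : x * D = D' * x)
    (hb : star x * b + star b * x + star b * (1 - x * star x) * b ≤ 1) :
    ‖x + D' * b * D‖ ≤ 1 := by
  have hxD' : star x * D' = D * star x := by
    simpa [hD.star_eq, hD'.star_eq] using congrArg star hxD.symm
  have hkey : star (x + D' * b * D) * (x + D' * b * D) = star x * x +
      D * (star x * b + star b * x + star b * (1 - x * star x) * b) * D := by
    rw [← hDD']
    simp only [star_add, star_mul, hD.star_eq, hD'.star_eq, mul_add, add_mul]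
    have h₁ : star x * (D' * b * D) = D * (star x * b) * D := by
      simp only [← mul_assoc, hxD']
    have h₂ : D * (star b * D') * x = D * (star b * x) * D := by
      simp only [mul_assoc, hxD]
    rw [h₁, h₂]
    simp only [mul_assoc]
    abel
  have hle := hD.conjugate_le_conjugate hb
  rw [mul_one, hDD] at hle
  have : ‖star (x + D' * b * D) * (x + D' * b * D)‖ ≤ 1 := by
    rw [norm_le_one_iff_of_nonneg _ (star_mul_self_nonneg _), hkey]
    calc _ ≤ star x * x + (1 - star x * x) := by gcongr
      _ = 1 := by abel
  rw [CStarRing.norm_star_mul_self] at this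
  nlinarith [norm_nonneg (x + D' * b * D)]

/-- If `x` lies in a face of the unit ball and some `x + t` with `0 < |t| < 1` is invertible, then
the Möbius transform of `t` at `x` is an invertible element of the face. -/
lemma IsFace.exists_isUnit [Nontrivial A] {E : Set A} (hE : IsFace E) {x : A} (hx : x ∈ E) {t : ℝ}
    (ht0 : t ≠ 0) (ht : |t| < 1) (hunit : IsUnit (x + t • (1 : A))) : ∃ y ∈ E, IsUnit y := by
  let _ := CStarAlgebra.spectralOrder A
  let _ := CStarAlgebra.spectralOrderedRing A
  have hx1 : ‖x‖ ≤ 1 := by simpa using hE.2.2.subset hx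
  obtain ⟨D, D', hD, hD', hDD, hDD', hxD⟩ := exists_defect hx1
  have hxD' : star x * D' = D * star x := by
    simpa [hD.star_eq, hD'.star_eq] using congrArg star hxD.symm
  obtain ⟨τ, hτ⟩ : ∃ τ : ℝ, τ * t = 1 := ⟨t⁻¹, inv_mul_cancel₀ ht0⟩
  have hτ1 : 1 < |τ| := by
    have h := congrArg abs hτ
    rw [abs_mul, abs_one] at h
    nlinarith [abs_nonneg t, abs_nonneg τ]
  have hunit' : IsUnit (τ • (1 : A) + star x) := by
    have hlt : ‖t • star x‖ < 1 := by
      rw [norm_smul, norm_star, Real.norm_eq_abs]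
      nlinarith [abs_nonneg t, norm_nonneg x]
    have hu : IsUnit (1 + t • star x) := by
      simpa using isUnit_one_sub_of_norm_lt_one (x := -(t • star x)) (by simpa using hlt)
    have hτ0 : τ ≠ 0 := left_ne_zero_of_mul_eq_one hτ
    have : τ • (1 : A) + star x = τ • (1 + t • star x) := by
      rw [smul_add, smul_smul, hτ, one_smul]
    rw [this]
    exact hu.smul (Units.mk0 τ hτ0)
  obtain ⟨G, hxG, hGx⟩ := isUnit_iff_exists.1 hunit
  obtain ⟨B, hsB, hBs⟩ := isUnit_iff_exists.1 hunit'
  have hxG' : x * G = 1 - t • G := by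
    rw [eq_sub_iff_add_eq]; simpa [add_mul] using hxG
  have hGx' : G * x = 1 - t • G := by
    rw [eq_sub_iff_add_eq]; simpa [mul_add] using hGx
  have hsB' : star x * B = 1 - τ • B := by
    rw [eq_sub_iff_add_eq']; simpa [add_mul] using hsB
  have hBs' : B * star x = 1 - τ • B := by
    rw [eq_sub_iff_add_eq']; simpa [mul_add] using hBs
  have hBx' : star B * x = 1 - τ • star B := by
    simpa using congrArg star hsB'
  refine ⟨x + D' * B * D, ?_, isUnit_iff_exists.2 ⟨star x + D * G * D', ?_, ?_⟩⟩
  · have hball : ∀ b : A, star x * b + star b * x + star b * (1 - x * star x) * b ≤ 1 →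
        x + D' * b * D ∈ closedBall (0 : A) 1 := fun b hb ↦ by
      simpa using norm_add_defect_mul_le_one hD hD' hDD hDD' hxD hb
    set κ : ℝ := 1 / (3 * (‖B‖ + 1)) with hκ_def
    have hκ : 0 < κ := by positivity
    have hκB : ‖(-κ) • B‖ ≤ 1 / 3 := by
      rw [norm_smul, norm_neg, Real.norm_eq_abs, abs_of_pos hκ, hκ_def, div_mul_eq_mul_div,
        div_le_div_iff₀ (by positivity) (by norm_num)]
      linarith
    refine hE.2.2.left_mem_of_mem_openSegment (hball B ?_) (hball ((-κ) • B) ?_) hx ?_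
    · have hbracket : star x * B + star B * x + star B * (1 - x * star x) * B =
          1 - (τ ^ 2 - 1) • (star B * B) := by
        have : star B * (1 - x * star x) * B = star B * B - (star B * x) * (star x * B) := by
          noncomm_ring
        rw [this, hsB', hBx']
        simp only [mul_sub, sub_mul, mul_one, one_mul, smul_mul_assoc, mul_smul_comm]
        module
      rw [hbracket, sub_le_self_iff]
      have : 0 ≤ τ ^ 2 - 1 := by nlinarith [sq_abs τ]
      exact smul_nonneg this (star_mul_self_nonneg B)
    · set b := (-κ) • B
      have hsa : IsSelfAdjoint (star x * b + star b * x + star b * (1 - x * star x) * b) := by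
        rw [isSelfAdjoint_iff]
        simp only [star_add, star_mul, star_star, star_sub, star_one, mul_assoc]
        abel
      refine hsa.le_algebraMap_norm_self.trans ?_
      refine (algebraMap_mono A (?_ : _ ≤ (1 : ℝ))).trans (map_one _).le
      have h₁ : ‖star x * b‖ ≤ 1 * (1 / 3) := (norm_mul_le _ _).trans (by rw [norm_star]; gcongr)
      have h₂ : ‖star b * x‖ ≤ 1 / 3 * 1 := (norm_mul_le _ _).trans (by rw [norm_star]; gcongr)
      have h₃ : ‖1 - x * star x‖ ≤ 1 + 1 * 1 := by
        refine (norm_sub_le _ _).trans (add_le_add CStarRing.norm_one.le ?_)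
        exact (norm_mul_le _ _).trans (by rw [norm_star]; gcongr)
      have h₄ : ‖star b * (1 - x * star x) * b‖ ≤ 1 / 3 * (1 + 1 * 1) * (1 / 3) := by
        refine (norm_mul_le _ _).trans (mul_le_mul ?_ hκB (norm_nonneg _) (by norm_num))
        exact (norm_mul_le _ _).trans (by rw [norm_star]; gcongr)
      refine (norm_add₃_le).trans ?_
      linarith
    · refine ⟨κ / (1 + κ), 1 / (1 + κ), by positivity, by positivity, by field_simp; ring, ?_⟩
      simp only [mul_smul_comm, smul_mul_assoc]
      match_scalars <;> field_simp <;> ring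
  · have hbracket : x * G + B * star x + B * (1 - star x * x) * G = 1 := by
      have : B * (1 - star x * x) * G = B * G - (B * star x) * (x * G) := by noncomm_ring
      rw [this, hBs', hxG']
      simp only [mul_sub, sub_mul, mul_one, one_mul, smul_mul_assoc, mul_smul_comm, smul_smul,
        smul_sub, hτ, mul_comm t τ, one_smul]
      abel
    calc _ = x * star x + D' * (x * G + B * star x + B * (D * D) * G) * D' := by
          simp only [mul_add, add_mul, ← mul_assoc, hxD]
          simp only [mul_assoc, hxD']
          abel
      _ = 1 := by
          rw [hDD, hbracket, mul_one, hDD']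
          abel
  · have hbracket : star x * B + G * x + G * (1 - x * star x) * B = 1 := by
      have : G * (1 - x * star x) * B = G * B - (G * x) * (star x * B) := by noncomm_ring
      rw [this, hsB', hGx']
      simp only [mul_sub, sub_mul, mul_one, one_mul, smul_mul_assoc, mul_smul_comm, smul_smul,
        smul_sub, hτ, one_smul]
      abel
    calc _ = star x * x + D * (star x * B + G * x + G * (D' * D') * B) * D := by
          simp only [mul_add, add_mul, ← mul_assoc, hxD']
          simp only [mul_assoc, hxD]
          abel
      _ = 1 := by
          rw [hDD', hbracket, mul_one, hDD]
          abel

/-- A maximal face of the unit sphere of a unital C⋆-algebra contains an invertible element. -/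
lemma IsMaximalFace.exists_isUnit {E : Set A} (hE : IsMaximalFace E) : ∃ y ∈ E, IsUnit y := by
  obtain ⟨e₀, he₀⟩ := hE.1.1
  have : Nontrivial A := ⟨e₀, 0, by
    rintro rfl
    simpa using hE.norm_eq_one he₀⟩
  by_cases h1 : (1 : A) ∈ E
  · exact ⟨1, h1, isUnit_one⟩
  obtain ⟨x, hx, hlt⟩ : ∃ x ∈ E, ‖x + 1‖ < 2 := by
    by_contra! h
    exact h1 (hE.mem_of_two_le_norm_add CStarRing.norm_one.le h)
  have hunit : IsUnit (x + (-1 : ℝ) • (1 : A)) := by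
    have h := isUnit_one_sub_of_norm_lt_one (x := (2⁻¹ : ℝ) • (x + 1)) (by
      rw [norm_smul]; norm_num; linarith)
    have heq : x + (-1 : ℝ) • (1 : A) = (-2 : ℝ) • (1 - (2⁻¹ : ℝ) • (x + 1)) := by module
    rw [heq]
    exact h.smul (Units.mk0 (-2 : ℝ) (by norm_num))
  have hnhds : ∀ᶠ t in nhds (-1 : ℝ), IsUnit (x + t • (1 : A)) :=
    (by fun_prop : Continuous fun t : ℝ ↦ x + t • (1 : A)).continuousAt.eventually
      (Units.isOpen.mem_nhds hunit)
  obtain ⟨δ, hδ, hball⟩ := Metric.eventually_nhds_iff.1 hnhds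
  have hmin : 0 < min (δ / 2) (1 / 2) := by positivity
  have hmin₁ := min_le_left (δ / 2) (1 / 2)
  have hmin₂ := min_le_right (δ / 2) (1 / 2)
  refine hE.1.exists_isUnit hx (t := -1 + min (δ / 2) (1 / 2)) (by linarith) ?_ (hball ?_)
  · rw [abs_lt]
    constructor <;> linarith
  · rw [Real.dist_eq, add_sub_cancel_left, abs_of_pos hmin]
    linarith

/-- An invertible contraction in a C⋆-algebra is the mean of two unitary elements. -/
lemma exists_unitary_mean_of_isUnit {y : A} (hy : IsUnit y) (hy1 : ‖y‖ ≤ 1) :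
    ∃ u ∈ unitary A, ∃ v ∈ unitary A, y = (1 / 2 : ℝ) • u + (1 / 2 : ℝ) • v := by
  let _ := CStarAlgebra.spectralOrder A
  let _ := CStarAlgebra.spectralOrderedRing A
  have hp : IsSelfAdjoint (CFC.abs y) := (CFC.abs_nonneg y).isSelfAdjoint
  have hpu : IsUnit (CFC.abs y) := by
    rw [← isUnit_pow_iff two_ne_zero, CFC.abs_sq]
    exact hy.star.mul hy
  obtain ⟨q, hpq, hqp⟩ := isUnit_iff_exists.1 hpu
  have hq : star q = q := by
    have h : star q * CFC.abs y = 1 := by simpa [hp.star_eq] using congrArg star hpq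
    exact left_inv_eq_right_inv h hpq
  have hw : y * q ∈ unitary A := by
    have hstar : star (y * q) * (y * q) = 1 := by
      calc _ = q * (star y * y) * q := by rw [star_mul, hq]; simp only [mul_assoc]
        _ = (q * CFC.abs y) * (CFC.abs y * q) := by rw [← CFC.abs_mul_abs]; simp only [mul_assoc]
        _ = 1 := by rw [hpq, hqp, one_mul]
    have hyq : IsUnit (y * q) := hy.mul (isUnit_iff_exists.2 ⟨_, hqp, hpq⟩)
    refine Unitary.mem_iff.2 ⟨hstar, ?_⟩
    obtain ⟨r, hr, -⟩ := isUnit_iff_exists.1 hyq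
    rwa [left_inv_eq_right_inv hstar hr]
  have hs := hp.self_add_I_smul_cfcSqrt_sub_sq_mem_unitary _ (CFC.norm_abs.trans_le hy1)
  refine ⟨_, mul_mem hw hs, _, mul_mem hw (Unitary.star_mem hs), ?_⟩
  have hsum : ∀ s : A, IsSelfAdjoint s → y = (1 / 2 : ℝ) • (y * q * (CFC.abs y + Complex.I • s)) +
      (1 / 2 : ℝ) • (y * q * star (CFC.abs y + Complex.I • s)) := by
    intro s hs
    have hyp : y * q * CFC.abs y = y := by rw [mul_assoc, hqp, mul_one]
    rw [star_add, star_smul, hs.star_eq, hp.star_eq, mul_add, mul_add, hyp, ← smul_add]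
    simp only [Complex.star_def, Complex.conj_I, neg_smul, mul_neg]
    module
  exact hsum _ (CFC.sqrt_nonneg _).isSelfAdjoint

lemma norm_le_one_of_mem_unitary {u : A} (hu : u ∈ unitary A) : ‖u‖ ≤ 1 := by
  obtain (_ | _) := subsingleton_or_nontrivial A
  · simp [Subsingleton.elim u 0]
  · exact (CStarRing.norm_of_mem_unitary hu).le

/-- An invertible element of a face is a convex combination of unitary elements of the face. -/
lemma IsFace.mem_convexHull_of_isUnit {E : Set A} (hE : IsFace E) {y : A} (hy : y ∈ E)
    (hunit : IsUnit y) : y ∈ convexHull ℝ {x ∈ E | x ∈ unitary A} := by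
  have hball : ∀ u ∈ unitary A, u ∈ closedBall (0 : A) 1 := fun u hu ↦ by
    simpa using norm_le_one_of_mem_unitary hu
  obtain ⟨u, hu, v, hv, hyuv⟩ :=
    exists_unitary_mean_of_isUnit hunit (by simpa using hE.2.2.subset hy)
  have hyuv' : y = (1 / 2 : ℝ) • v + (1 / 2 : ℝ) • u := by rw [hyuv, add_comm]
  have huE : u ∈ E := hE.2.2.left_mem_of_mem_openSegment (hball u hu) (hball v hv) hy
    ⟨1 / 2, 1 / 2, by norm_num, by norm_num, by norm_num, hyuv.symm⟩
  have hvE : v ∈ E := hE.2.2.left_mem_of_mem_openSegment (hball v hv) (hball u hu) hy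
    ⟨1 / 2, 1 / 2, by norm_num, by norm_num, by norm_num, hyuv'.symm⟩
  rw [hyuv]
  have hsub := subset_convexHull ℝ {x ∈ E | x ∈ unitary A}
  exact convex_convexHull ℝ _ (hsub ⟨huE, hu⟩) (hsub ⟨hvE, hv⟩)
    (by norm_num) (by norm_num) (by norm_num)

/-- The midpoint of an element and a unitary element of a face is a limit of convex combinations of
unitary elements of the face. -/
lemma IsFace.midpoint_mem_closure_convexHull {E : Set A} (hE : IsFace E) {x u : A} (hx : x ∈ E)
    (huE : u ∈ E) (hu : u ∈ unitary A) :
    (1 / 2 : ℝ) • x + (1 / 2 : ℝ) • u ∈ closure (convexHull ℝ {x ∈ E | x ∈ unitary A}) := by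
  have hx1 : ‖x‖ ≤ 1 := by simpa using hE.2.2.subset hx
  have hmem : ∀ s ∈ Set.Ioo (0 : ℝ) (1 / 2),
      s • x + (1 - s) • u ∈ convexHull ℝ {x ∈ E | x ∈ unitary A} := by
    rintro s ⟨hs0, hs⟩
    refine hE.mem_convexHull_of_isUnit
      (hE.2.1 hx huE hs0.le (by linarith) (by ring)) ?_
    have hs1 : 0 < 1 - s := by linarith
    have hlt : ‖(-(s / (1 - s))) • (star u * x)‖ < 1 := by
      have hux : ‖star u * x‖ ≤ 1 := (norm_mul_le _ _).trans <| by
        have := norm_le_one_of_mem_unitary (Unitary.star_mem hu)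
        exact mul_le_one₀ this (norm_nonneg _) hx1
      rw [norm_smul, norm_neg, Real.norm_eq_abs, abs_of_pos (by positivity)]
      calc s / (1 - s) * ‖star u * x‖ ≤ s / (1 - s) * 1 := by gcongr
        _ < 1 := by rw [mul_one, div_lt_one hs1]; linarith
    have hunit := isUnit_one_sub_of_norm_lt_one hlt
    have huu : IsUnit u := isUnit_iff_exists.2 ⟨star u, hu.2, hu.1⟩
    have heq : s • x + (1 - s) • u =
        (1 - s) • (u * (1 - (-(s / (1 - s))) • (star u * x))) := by
      rw [mul_sub, mul_smul_comm, ← mul_assoc, hu.2, one_mul, mul_one]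
      match_scalars <;> field_simp
    rw [heq]
    exact (huu.mul hunit).smul (Units.mk0 (1 - s) hs1.ne')
  have hcont : Continuous fun s : ℝ ↦ s • x + (1 - s) • u := by fun_prop
  have hhalf : (1 / 2 : ℝ) ∈ closure (Set.Ioo (0 : ℝ) (1 / 2)) := by
    rw [closure_Ioo (by norm_num)]
    constructor <;> norm_num
  have := map_mem_closure hcont hhalf hmem
  convert this using 3
  norm_num

end CStarAlgebra

/-- A maximal face `E` of the unit sphere of a unital complex C*-algebra coincides with the
closed convex hull of the unitary elements contained in `E`. -/
theorem maximalFace_eq_closure_convexHull_unitary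
    (A : Type*) [CStarAlgebra A] (E : Set A) (hE : IsMaximalFace E) :
    E = closure (convexHull ℝ {x ∈ E | x ∈ unitary A}) := by
  refine Set.Subset.antisymm (fun x hx ↦ ?_) ?_
  · set C := closure (convexHull ℝ {x ∈ E | x ∈ unitary A})
    have hC : Convex ℝ C := (convex_convexHull ℝ _).closure
    have hmid : ∀ c ∈ C, (1 / 2 : ℝ) • x + (1 / 2 : ℝ) • c ∈ C := by
      let g : A → A := fun c ↦ (1 / 2 : ℝ) • x + (1 / 2 : ℝ) • c
      have hg : Continuous g := by fun_prop
      have hconv : Convex ℝ (g ⁻¹' C) := by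
        intro a ha b hb s t hs ht hst
        have heq : g (s • a + t • b) = s • g a + t • g b := by
          obtain rfl : t = 1 - s := by linarith
          simp only [g]
          module
        rw [Set.mem_preimage, heq]
        exact hC ha hb hs ht hst
      exact closure_minimal (convexHull_min
        (fun u hu ↦ hE.1.midpoint_mem_closure_convexHull hx hu.1 hu.2) hconv)
        (isClosed_closure.preimage hg)
    obtain ⟨c, hc⟩ : C.Nonempty := by
      obtain ⟨y, hy, hunit⟩ := hE.exists_isUnit
      exact ⟨y, subset_closure (hE.1.mem_convexHull_of_isUnit hy hunit)⟩
    have hseq : ∀ n : ℕ, x + (1 / 2 : ℝ) ^ n • (c - x) ∈ C := by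
      intro n
      induction n with
      | zero => simpa using hc
      | succ n ih =>
        convert hmid _ ih using 1
        rw [pow_succ]
        module
    have hlim : Filter.Tendsto (fun n : ℕ ↦ x + (1 / 2 : ℝ) ^ n • (c - x)) Filter.atTop
        (nhds x) := by
      have h := tendsto_pow_atTop_nhds_zero_of_lt_one (r := (1 / 2 : ℝ)) (by norm_num) (by norm_num)
      simpa using (h.smul_const (c - x)).const_add x
    exact isClosed_closure.mem_of_tendsto hlim (Filter.Eventually.of_forall hseq)
  · exact closure_minimal (convexHull_min (fun u hu ↦ hu.1) hE.1.2.1) hE.isClosed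
end

section
/- Let A be a unital complex C*-algebra and ψ : A → ℂ a nonzero multiplicative linear functional. Then the closed unit ball of the real Banach algebra A^ψ_ℝ := ψ⁻¹(ℝ) = {a ∈ A : ψ(a) ∈ ℝ}, a closed real subalgebra of A, has the strong Mankiewicz property. -/
/-- A convex subset `K` of a real normed space `X` has the *strong Mankiewicz property* if
every surjective isometry `T` from `K` onto an arbitrary convex subset `L` of an arbitrary
real normed space `Y` is affine. -/
def StrongMankiewiczProp {X : Type*} [NormedAddCommGroup X] [NormedSpace ℝ X]
    (K : Set X) : Prop :=
  ∀ (Y : Type*) [NormedAddCommGroup Y] [NormedSpace ℝ Y] (L : Set Y), Convex ℝ L →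
    ∀ T : X → Y, (∀ x ∈ K, ∀ y ∈ K, dist (T x) (T y) = dist x y) → T '' K = L →
      ∀ x ∈ K, ∀ y ∈ K, ∀ α ∈ Set.Icc (0 : ℝ) 1,
        T (α • x + (1 - α) • y) = α • T x + (1 - α) • T y

open Set Metric Complex
open scoped Pointwise ComplexStarModule

/-- A continuous function on `[0, 1]` that is locally midpoint-affine in the interior is affine. -/
lemma eq_lineMap_of_locally_midpoint {Y : Type*} [NormedAddCommGroup Y] [NormedSpace ℝ Y]
    {g : ℝ → Y} (hg : ContinuousOn g (Icc 0 1))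
    (hmid : ∀ s ∈ Ioo (0 : ℝ) 1, ∃ ε > 0, ∀ t ∈ Ioo 0 ε, g (s + t) + g (s - t) = (2 : ℝ) • g s)
    {s : ℝ} (hs : s ∈ Icc (0 : ℝ) 1) : g s = s • g 1 + (1 - s) • g 0 := by
  set d : ℝ → Y := fun s ↦ g s - (s • g 1 + (1 - s) • g 0) with hd
  have hdc : ContinuousOn (fun s ↦ ‖d s‖) (Icc 0 1) := by
    have : Continuous fun s : ℝ ↦ s • g 1 + (1 - s) • g 0 := by fun_prop
    exact (hg.sub this.continuousOn).norm
  obtain ⟨m, hm, hmax⟩ := isCompact_Icc.exists_isMaxOn ⟨s, hs⟩ hdc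
  have hcomp : IsCompact (Icc (0 : ℝ) 1 ∩ (fun s ↦ ‖d s‖) ⁻¹' {‖d m‖}) :=
    isCompact_Icc.of_isClosed_subset
      (hdc.preimage_isClosed_of_isClosed isClosed_Icc isClosed_singleton) inter_subset_left
  obtain ⟨a, ⟨ha, ham⟩, hleast⟩ := hcomp.exists_isLeast ⟨m, hm, rfl⟩
  have ham : ‖d a‖ = ‖d m‖ := ham
  have hzero : ‖d a‖ = 0 := by
    rcases ha.1.eq_or_lt with h0 | h0
    · simp [hd, ← h0]
    rcases ha.2.eq_or_lt with h1 | h1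
    · simp [hd, h1]
    obtain ⟨ε, hε, hεmid⟩ := hmid a ⟨h0, h1⟩
    obtain ⟨t, ht0, ht⟩ : ∃ t, 0 < t ∧ t < min ε (min a (1 - a)) :=
      exists_between (by simp [hε, h0, h1])
    rw [lt_min_iff, lt_min_iff] at ht
    have hsum : d (a + t) + d (a - t) = (2 : ℝ) • d a := by
      have := hεmid t ⟨ht0, ht.1⟩
      have e : g (a + t) = (2 : ℝ) • g a - g (a - t) := by rw [← this]; abel
      simp only [hd, e]
      module
    have hp : ‖d (a + t)‖ ≤ ‖d m‖ := hmax (a := a + t) ⟨by linarith, by linarith⟩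
    have hn : ‖d (a - t)‖ ≤ ‖d m‖ := hmax (a := a - t) ⟨by linarith, by linarith⟩
    have htri : 2 * ‖d a‖ ≤ ‖d (a + t)‖ + ‖d (a - t)‖ := by
      have := norm_add_le (d (a + t)) (d (a - t))
      rwa [hsum, norm_smul, Real.norm_two] at this
    have : a ≤ a - t := hleast
      ⟨⟨by linarith, by linarith⟩, show ‖d (a - t)‖ = ‖d m‖ by linarith⟩
    linarith
  have : ‖d s‖ ≤ ‖d m‖ := hmax hs
  exact sub_eq_zero.1 (norm_le_zero_iff.1 (show ‖d s‖ ≤ 0 by linarith))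

section ExtremeDirections

variable {X : Type*} [NormedAddCommGroup X] [NormedSpace ℝ X]

lemma eq_zero_of_norm_smul_add_le_of_mem_extremePoints {u : X}
    (hu : u ∈ extremePoints ℝ (closedBall (0 : X) 1)) {t : ℝ} {z : X}
    (hadd : ‖t • u + z‖ ≤ |t|) (hsub : ‖t • u - z‖ ≤ |t|) : z = 0 := by
  rcases eq_or_ne t 0 with rfl | ht
  · simpa using hadd
  have hscale (y : X) (hy : ‖t • u + y‖ ≤ |t|) : u + t⁻¹ • y ∈ closedBall (0 : X) 1 := by
    have : u + t⁻¹ • y = t⁻¹ • (t • u + y) := by rw [smul_add, inv_smul_smul₀ ht]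
    rw [mem_closedBall_zero_iff, this, norm_smul, norm_inv, Real.norm_eq_abs]
    exact inv_mul_le_one_of_le₀ hy (abs_nonneg t)
  have hmem : u ∈ openSegment ℝ (u + t⁻¹ • z) (u + t⁻¹ • (-z)) :=
    ⟨1 / 2, 1 / 2, by norm_num, by norm_num, by norm_num, by module⟩
  have := (mem_extremePoints_iff_left.1 hu).2 _ (hscale z hadd) _
    (hscale (-z) (by rwa [← sub_eq_add_neg])) hmem
  simpa [ht] using this

variable {Y : Type*} [NormedAddCommGroup Y] [NormedSpace ℝ Y]

/-- If an isometry with convex range preserves the midpoints of two segments in direction `v`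
centred at `p ± t • u`, where `u` is an extreme point of the unit ball, then it preserves the
midpoint of the diagonal of the parallelogram they form. -/
lemma map_add_map_eq_of_mem_extremePoints {K : Set X} {T : X → Y}
    (hT : ∀ x ∈ K, ∀ y ∈ K, dist (T x) (T y) = dist x y) (hconv : Convex ℝ (T '' K)) {u : X}
    (hu : u ∈ extremePoints ℝ (closedBall (0 : X) 1)) {p v : X} {t : ℝ}
    (h₁ : p + t • u ∈ K) (h₂ : p - t • u ∈ K)
    (h₁₁ : p + t • u + v ∈ K) (h₁₂ : p + t • u - v ∈ K)
    (h₂₁ : p - t • u + v ∈ K) (h₂₂ : p - t • u - v ∈ K)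
    (hm₁ : T (p + t • u + v) + T (p + t • u - v) = (2 : ℝ) • T (p + t • u))
    (hm₂ : T (p - t • u + v) + T (p - t • u - v) = (2 : ℝ) • T (p - t • u)) :
    T (p + t • u + v) + T (p - t • u - v) = (2 : ℝ) • T p := by
  have hnu : ‖u‖ ≤ 1 := mem_closedBall_zero_iff.1 hu.1
  obtain ⟨q, hq, hqT⟩ : (1 / 2 : ℝ) • T (p + t • u + v) + (1 / 2 : ℝ) • T (p - t • u - v) ∈
      T '' K :=
    hconv (mem_image_of_mem T h₁₁) (mem_image_of_mem T h₂₂) (by norm_num) (by norm_num)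
      (by norm_num)
  have hbound (w : X) (hw : w = (2 : ℝ) • (t • u)) : (1 / 2) * ‖w‖ ≤ |t| := by
    rw [hw, norm_smul, norm_smul, Real.norm_two, Real.norm_eq_abs]
    nlinarith [abs_nonneg t]
  have hd₁ : ‖t • u - (q - p)‖ ≤ |t| := by
    have e : T (p + t • u) - T q = (1 / 2 : ℝ) • (T (p + t • u - v) - T (p - t • u - v)) := by
      have : T (p + t • u) = (1 / 2 : ℝ) • (T (p + t • u + v) + T (p + t • u - v)) := by
        rw [hm₁]; module
      rw [hqT, this]; module
    rw [show t • u - (q - p) = p + t • u - q by abel, ← dist_eq_norm, ← hT _ h₁ _ hq,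
      dist_eq_norm, e, norm_smul, ← dist_eq_norm, hT _ h₁₂ _ h₂₂, dist_eq_norm]
    simpa using hbound _ (by module)
  have hd₂ : ‖t • u + (q - p)‖ ≤ |t| := by
    have e : T q - T (p - t • u) = (1 / 2 : ℝ) • (T (p + t • u + v) - T (p - t • u + v)) := by
      have : T (p - t • u) = (1 / 2 : ℝ) • (T (p - t • u + v) + T (p - t • u - v)) := by
        rw [hm₂]; module
      rw [hqT, this]; module
    rw [show t • u + (q - p) = q - (p - t • u) by abel, ← dist_eq_norm, ← hT _ hq _ h₂,
      dist_eq_norm, e, norm_smul, ← dist_eq_norm, hT _ h₁₁ _ h₂₁, dist_eq_norm]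
    simpa using hbound _ (by module)
  have hqp : q = p := sub_eq_zero.1 (eq_zero_of_norm_smul_add_le_of_mem_extremePoints hu hd₂ hd₁)
  rw [hqp] at hqT
  rw [hqT]
  module

/-- An isometry with convex range from the unit ball of a space spanned by extreme points preserves
midpoints of segments that are short compared to the distance to the boundary. -/
lemma exists_map_add_map_sub_eq_of_mem_span {U : Set X}
    (hU : U ⊆ extremePoints ℝ (closedBall (0 : X) 1)) {T : X → Y}
    (hT : ∀ x ∈ {a | ‖a‖ ≤ 1 ∧ a ∈ Submodule.span ℝ U},
      ∀ y ∈ {a | ‖a‖ ≤ 1 ∧ a ∈ Submodule.span ℝ U}, dist (T x) (T y) = dist x y)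
    (hconv : Convex ℝ (T '' {a | ‖a‖ ≤ 1 ∧ a ∈ Submodule.span ℝ U})) {w : X}
    (hw : w ∈ Submodule.span ℝ U) :
    ∃ C : ℝ, ‖w‖ ≤ C ∧ ∀ p ∈ Submodule.span ℝ U, ∀ t : ℝ, ‖p‖ + |t| * C ≤ 1 →
      T (p + t • w) + T (p - t • w) = (2 : ℝ) • T p := by
  have hw' : w ∈ AddSubmonoid.closure ((univ : Set ℝ) • U) := by
    rwa [← Submodule.span_eq_closure, Submodule.mem_toAddSubmonoid]
  clear hw
  induction hw' using AddSubmonoid.closure_induction_left with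
  | zero => exact ⟨0, by simp, fun p _ t _ ↦ by simp [two_smul]⟩
  | add_left x hx v hv ih =>
    obtain ⟨r, -, u, hu, rfl⟩ := hx
    obtain ⟨C, hvC, hC⟩ := ih
    have hv : v ∈ Submodule.span ℝ U := by
      rwa [← Submodule.mem_toAddSubmonoid, Submodule.span_eq_closure]
    have hnu : ‖u‖ ≤ 1 := mem_closedBall_zero_iff.1 (hU hu).1
    have hru (s : ℝ) : ‖s • u‖ ≤ |s| := by
      rw [norm_smul, Real.norm_eq_abs]
      exact mul_le_of_le_one_right (abs_nonneg s) hnu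
    refine ⟨|r| + C, (norm_add_le _ _).trans (add_le_add (hru r) hvC), fun p hp t hpt ↦ ?_⟩
    have htu : ‖(t * r) • u‖ ≤ |t| * |r| := (hru _).trans (abs_mul t r).le
    have htv : ‖t • v‖ ≤ |t| * C := by
      rw [norm_smul, Real.norm_eq_abs]
      exact mul_le_mul_of_nonneg_left hvC (abs_nonneg t)
    have hC0 : 0 ≤ |t| * C := (norm_nonneg _).trans htv
    have htr0 : 0 ≤ |t| * |r| := by positivity
    have husp : (t * r) • u ∈ Submodule.span ℝ U :=
      Submodule.smul_mem _ _ (Submodule.subset_span hu)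
    have hvsp : t • v ∈ Submodule.span ℝ U := Submodule.smul_mem _ _ hv
    have hadd := norm_add_le p ((t * r) • u)
    have hsub := norm_sub_le p ((t * r) • u)
    have key := map_add_map_eq_of_mem_extremePoints hT hconv (hU hu) (p := p) (v := t • v)
      (t := t * r) ⟨by linarith, add_mem hp husp⟩
      ⟨by linarith, sub_mem hp husp⟩
      ⟨by linarith [norm_add_le (p + (t * r) • u) (t • v)], add_mem (add_mem hp husp) hvsp⟩
      ⟨by linarith [norm_sub_le (p + (t * r) • u) (t • v)], sub_mem (add_mem hp husp) hvsp⟩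
      ⟨by linarith [norm_add_le (p - (t * r) • u) (t • v)], add_mem (sub_mem hp husp) hvsp⟩
      ⟨by linarith [norm_sub_le (p - (t * r) • u) (t • v)], sub_mem (sub_mem hp husp) hvsp⟩
      (hC _ (add_mem hp husp) t (by linarith)) (hC _ (sub_mem hp husp) t (by linarith))
    rw [← key]
    congr 2 <;> module

/-- The unit ball of a subspace spanned by extreme points of the ambient unit ball has the strong
Mankiewicz property. -/
theorem strongMankiewiczProp_ball_span {U : Set X}
    (hU : U ⊆ extremePoints ℝ (closedBall (0 : X) 1)) :
    StrongMankiewiczProp {a : X | ‖a‖ ≤ 1 ∧ a ∈ Submodule.span ℝ U} := by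
  intro Y _ _ L hL T hT hTL x hx y hy α hα
  set K := {a : X | ‖a‖ ≤ 1 ∧ a ∈ Submodule.span ℝ U}
  have hconv : Convex ℝ (T '' K) := hTL ▸ hL
  have hcont : ContinuousOn T K := by
    refine (LipschitzOnWith.of_dist_le_mul (K := 1) fun a ha b hb ↦ ?_).continuousOn
    simp [hT a ha b hb]
  have hcomb {s r : ℝ} (hs : s ∈ Icc (0 : ℝ) 1) (hr : r ∈ Icc (0 : ℝ) 1) :
      r • (s • x + (1 - s) • y) ∈ Submodule.span ℝ U ∧ ‖r • (s • x + (1 - s) • y)‖ ≤ r := by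
    refine ⟨Submodule.smul_mem _ _ (add_mem (Submodule.smul_mem _ _ hx.2)
      (Submodule.smul_mem _ _ hy.2)), ?_⟩
    have h1 : ‖s • x + (1 - s) • y‖ ≤ 1 := by
      have := (convex_closedBall (0 : X) 1) (mem_closedBall_zero_iff.2 hx.1)
        (mem_closedBall_zero_iff.2 hy.1) hs.1 (sub_nonneg.2 hs.2) (by ring)
      exact mem_closedBall_zero_iff.1 this
    rw [norm_smul, Real.norm_of_nonneg hr.1]
    exact mul_le_of_le_one_right hr.1 h1
  have hmemK {s r : ℝ} (hs : s ∈ Icc (0 : ℝ) 1) (hr : r ∈ Icc (0 : ℝ) 1) :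
      r • (s • x + (1 - s) • y) ∈ K := ⟨(hcomb hs hr).2.trans hr.2, (hcomb hs hr).1⟩
  have hinner {r : ℝ} (hr : r ∈ Ico (0 : ℝ) 1) :
      T (r • (α • x + (1 - α) • y)) =
        α • T (r • ((1 : ℝ) • x + (1 - 1 : ℝ) • y)) +
          (1 - α) • T (r • ((0 : ℝ) • x + (1 - 0 : ℝ) • y)) := by
    have hr' : r ∈ Icc (0 : ℝ) 1 := ⟨hr.1, hr.2.le⟩
    obtain ⟨C, hwC, hC⟩ := exists_map_add_map_sub_eq_of_mem_span hU hT hconv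
      (Submodule.smul_mem _ r (sub_mem hx.2 hy.2))
    have hC0 : 0 ≤ C := (norm_nonneg _).trans hwC
    refine eq_lineMap_of_locally_midpoint (g := fun s ↦ T (r • (s • x + (1 - s) • y)))
      (hcont.comp (by fun_prop) fun s hs ↦ hmemK hs hr') (fun s hs ↦ ?_) hα
    have hs' : s ∈ Icc (0 : ℝ) 1 := ⟨hs.1.le, hs.2.le⟩
    refine ⟨(1 - r) / (C + 1), div_pos (by linarith [hr.2]) (by linarith), fun t ht ↦ ?_⟩
    have ht2 := (lt_div_iff₀ (by linarith : 0 < C + 1)).1 ht.2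
    have := hC _ (hcomb hs' hr').1 t (by
      rw [abs_of_pos ht.1]
      linarith [(hcomb hs' hr').2, ht.1])
    rw [← this]
    congr 2 <;> module
  have hlim : EqOn (fun r : ℝ ↦ T (r • (α • x + (1 - α) • y)))
      (fun r : ℝ ↦ α • T (r • ((1 : ℝ) • x + (1 - 1 : ℝ) • y)) +
          (1 - α) • T (r • ((0 : ℝ) • x + (1 - 0 : ℝ) • y))) (Icc 0 1) := by
    have hc {s : ℝ} (hs : s ∈ Icc (0 : ℝ) 1) :
        ContinuousOn (fun r : ℝ ↦ T (r • (s • x + (1 - s) • y))) (Icc 0 1) :=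
      hcont.comp (by fun_prop) fun r hr ↦ hmemK hs hr
    refine EqOn.of_subset_closure (fun r hr ↦ hinner hr) (hc hα)
      (((hc ⟨zero_le_one, le_rfl⟩).const_smul α).add
        ((hc ⟨le_rfl, zero_le_one⟩).const_smul (1 - α))) Ico_subset_Icc_self ?_
    rw [closure_Ico zero_ne_one]
  simpa using hlim (show (1 : ℝ) ∈ Icc 0 1 by simp)

end ExtremeDirections

section CStarAlgebra

variable {A : Type*} [CStarAlgebra A]

lemma mem_extremePoints_closedBall_of_mem_unitary {u : A} (hu : u ∈ unitary A) :
    u ∈ extremePoints ℝ (closedBall (0 : A) 1) := by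
  let _ := CStarAlgebra.spectralOrder A
  let _ := CStarAlgebra.spectralOrderedRing A
  have hle {x : A} (hx : x ∈ closedBall (0 : A) 1) : star x * x ≤ 1 := by
    rw [← CStarAlgebra.norm_le_one_iff_of_nonneg _ (star_mul_self_nonneg x),
      CStarRing.norm_star_mul_self]
    rw [mem_closedBall_zero_iff] at hx
    exact mul_le_one₀ hx (norm_nonneg x) hx
  have huu : star u * u = 1 := Unitary.star_mul_self_of_mem hu
  refine mem_extremePoints_iff_left.2 ⟨?_, fun x hx y hy ⟨a, b, ha, hb, hab, hu⟩ ↦ ?_⟩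
  · rw [mem_closedBall_zero_iff]
    rw [← sq_le_one_iff₀ (norm_nonneg u), sq, ← CStarRing.norm_star_mul_self,
      CStarAlgebra.norm_le_one_iff_of_nonneg _ (star_mul_self_nonneg u), huu]
  have hid : (a * b) • (star (x - y) * (x - y)) =
      a • (star x * x) + b • (star y * y) - star u * u := by
    obtain rfl : b = 1 - a := by linarith
    rw [← hu]
    simp only [star_sub, star_add, star_smul, star_trivial, mul_add, add_mul, mul_sub, sub_mul,
      smul_mul_assoc, mul_smul_comm]
    module
  have hnonpos : (a * b) • (star (x - y) * (x - y)) ≤ 0 := by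
    rw [hid, huu, sub_nonpos]
    calc a • (star x * x) + b • (star y * y) ≤ a • (1 : A) + b • (1 : A) :=
          add_le_add (smul_le_smul_of_nonneg_left (hle hx) ha.le)
            (smul_le_smul_of_nonneg_left (hle hy) hb.le)
      _ = 1 := by rw [← add_smul, hab, one_smul]
  have hzero := hnonpos.antisymm (smul_nonneg (mul_pos ha hb).le (star_mul_self_nonneg _))
  have hxy : x = y := by
    rw [smul_eq_zero_iff_right (mul_pos ha hb).ne', CStarRing.star_mul_self_eq_zero_iff] at hzero
    exact sub_eq_zero.1 hzero
  rw [← hu, ← hxy, ← add_smul, hab, one_smul]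

/-- The elements on which a character takes a real value are real combinations of unitaries with
the same property. -/
lemma mem_span_unitary_of_algHom_eq_ofReal (φ : A →ₐ[ℂ] ℂ) {a : A} {r : ℝ} (ha : φ a = r) :
    a ∈ Submodule.span ℝ {u : A | u ∈ unitary A ∧ ∃ r : ℝ, φ u = r} := by
  let _ := CStarAlgebra.spectralOrder A
  let _ := CStarAlgebra.spectralOrderedRing A
  have := AlgHomClass.instStarHomClass (F := A →ₐ[ℂ] ℂ) (A := A)
  set V := Submodule.span ℝ {u : A | u ∈ unitary A ∧ ∃ r : ℝ, φ u = r}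
  have hunit {u : A} (hu : u ∈ unitary A) {r : ℝ} (hr : φ u = r) : u ∈ V ∧ star u ∈ V :=
    ⟨Submodule.subset_span ⟨hu, r, hr⟩, Submodule.subset_span ⟨Unitary.star_mem hu, r, by
      rw [map_star, hr, Complex.star_def, Complex.conj_ofReal]⟩⟩
  have hsq {c : A} (hc : IsSelfAdjoint c) (hc1 : ‖c‖ ≤ 1) :
      φ (CFC.sqrt (1 - c ^ 2)) ^ 2 = 1 - φ c ^ 2 := by
    have h0 : 0 ≤ 1 - c ^ 2 := by
      rw [sub_nonneg, ← CStarAlgebra.norm_le_one_iff_of_nonneg (c ^ 2) hc.sq_nonneg, sq,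
        hc.norm_mul_self, sq_le_one_iff₀ (norm_nonneg c)]
      exact hc1
    rw [← map_pow, CFC.sq_sqrt (1 - c ^ 2) h0, map_sub, map_one, map_pow]
  have hstar (c : A) : star (CFC.sqrt (1 - c ^ 2)) = CFC.sqrt (1 - c ^ 2) :=
    (CFC.sqrt_nonneg (1 - c ^ 2)).isSelfAdjoint
  have hscale (x : A) : ‖(‖x‖ + 1)⁻¹ • x‖ ≤ 1 := by
    rw [norm_smul, norm_inv, Real.norm_of_nonneg (by positivity)]
    exact inv_mul_le_one_of_le₀ (by linarith) (by positivity)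
  have hpos0 (x : A) : 0 < (‖x‖ + 1)⁻¹ := by positivity
  have hφ (c : ℝ) (x : A) : φ (c • x) = c * φ x := by
    rw [← Complex.coe_smul, map_smul, smul_eq_mul]
  have hI {x : A} (hx : IsSelfAdjoint x) (h0 : φ x = 0) : I • x ∈ V := by
    wlog h1 : ‖x‖ ≤ 1 generalizing x
    · have := this ((IsSelfAdjoint.all (‖x‖ + 1)⁻¹).smul hx) (by rw [hφ, h0, mul_zero]) (hscale x)
      rwa [smul_comm, Submodule.smul_mem_iff _ (hpos0 x).ne'] at this
    have hu := hx.self_add_I_smul_cfcSqrt_sub_sq_mem_unitary x h1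
    have hIu : I • (x + I • CFC.sqrt (1 - x ^ 2)) ∈ unitary A :=
      Unitary.smul_mem_of_mem (by simp [Unitary.mem_iff]) hu
    have hs := hsq hx h1
    obtain ⟨r, hr⟩ : ∃ r : ℝ, φ (I • (x + I • CFC.sqrt (1 - x ^ 2))) = r := by
      rw [h0, zero_pow two_ne_zero, sub_zero, sq_eq_one_iff] at hs
      rcases hs with hs | hs
      · exact ⟨-1, by simp [h0, hs]⟩
      · exact ⟨1, by simp [h0, hs]⟩
    have := sub_mem (V.smul_mem (1 / 2) (hunit hIu hr).1) (V.smul_mem (1 / 2) (hunit hIu hr).2)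
    convert this using 1
    rw [star_smul, star_add, star_smul, hstar, hx.star_eq, Complex.star_def, Complex.conj_I]
    module
  have hpos {x : A} (hx : 0 ≤ x) (h0 : φ x = 0) : x ∈ V := by
    wlog h1 : ‖x‖ ≤ 1 generalizing x
    · have := this (smul_nonneg (hpos0 x).le hx) (by rw [hφ, h0, mul_zero]) (hscale x)
      rwa [Submodule.smul_mem_iff _ (hpos0 x).ne'] at this
    have hc : IsSelfAdjoint (1 - x) := (IsSelfAdjoint.one A).sub hx.isSelfAdjoint
    have hx1 : x ≤ 1 := (CStarAlgebra.norm_le_one_iff_of_nonneg x hx).1 h1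
    have hc1 : ‖1 - x‖ ≤ 1 :=
      (CStarAlgebra.norm_le_one_iff_of_nonneg _ (sub_nonneg.2 hx1)).2 (sub_le_self 1 hx)
    have hu := hc.self_add_I_smul_cfcSqrt_sub_sq_mem_unitary _ hc1
    have hs : φ (CFC.sqrt (1 - (1 - x) ^ 2)) = 0 := by simpa [h0] using hsq hc hc1
    have hr : φ (1 - x + I • CFC.sqrt (1 - (1 - x) ^ 2)) = (1 : ℝ) := by simp [h0, hs]
    have h1V : (1 : A) ∈ V := (hunit (one_mem _) (r := 1) (by simp)).1
    have := sub_mem h1V (V.smul_mem (1 / 2) (add_mem (hunit hu hr).1 (hunit hu hr).2))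
    convert this using 1
    rw [star_add, star_smul, hstar, hc.star_eq, Complex.star_def, Complex.conj_I]
    module
  have hsa {x : A} (hx : IsSelfAdjoint x) (h0 : φ x = 0) : x ∈ V := by
    have hsub : φ x⁺ = φ x⁻ := by
      rw [← sub_eq_zero, ← map_sub, CFC.posPart_sub_negPart x hx, h0]
    have hmul : φ x⁺ * φ x⁻ = 0 := by rw [← map_mul, CFC.posPart_mul_negPart, map_zero]
    have hneg : φ x⁻ = 0 := by simpa [hsub] using hmul
    rw [← CFC.posPart_sub_negPart x hx]
    exact sub_mem (hpos (CFC.posPart_nonneg x) (hsub.trans hneg))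
      (hpos (CFC.negPart_nonneg x) hneg)
  have hreal {x : A} (hx : IsSelfAdjoint x) : (φ x).im = 0 := by
    rw [← Complex.conj_eq_iff_im, ← Complex.star_def, ← map_star, hx.star_eq]
  set b := a - r • (1 : A) with hb
  have hφb : φ b = 0 := by rw [hb, map_sub, hφ, map_one, ha, mul_one, sub_self]
  have hdecomp := realPart_add_I_smul_imaginaryPart b
  have hφd : φ (ℜ b : A) + I * φ (ℑ b : A) = 0 := by
    rw [← smul_eq_mul, ← map_smul, ← map_add, hdecomp, hφb]
  have hre := hreal (ℜ b).2
  have him := hreal (ℑ b).2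
  have h0re : φ (ℜ b : A) = 0 := by
    apply Complex.ext
    · simpa [him] using congr_arg Complex.re hφd
    · simpa using hre
  have h0im : φ (ℑ b : A) = 0 := by simpa [h0re] using hφd
  have h1V : (1 : A) ∈ V := (hunit (one_mem _) (r := 1) (by simp)).1
  have hbV : b ∈ V := by
    rw [← hdecomp]
    exact add_mem (hsa (ℜ b).2 h0re) (hI (ℑ b).2 h0im)
  simpa [hb] using add_mem hbV (V.smul_mem r h1V)

end CStarAlgebra

/-- Let `A` be a unital complex C*-algebra and `ψ : A → ℂ` a nonzero multiplicative linear
functional. Then the closed unit ball of the real subalgebra `A^ψ_ℝ = ψ⁻¹(ℝ)` has the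
strong Mankiewicz property. -/
theorem strongMankiewicz_ball_of_multiplicative_functional
    (A : Type*) [CStarAlgebra A] (ψ : A →ₗ[ℂ] ℂ)
    (hmul : ∀ a b : A, ψ (a * b) = ψ a * ψ b) (hne : ψ ≠ 0) :
    StrongMankiewiczProp {a : A | ‖a‖ ≤ 1 ∧ ∃ r : ℝ, ψ a = (r : ℂ)} := by
  have hone : ψ 1 = 1 := by
    obtain ⟨a, ha⟩ := DFunLike.ne_iff.1 hne
    have := hmul a 1
    rw [mul_one] at this
    exact (mul_eq_left₀ ha).1 this.symm
  let φ : A →ₐ[ℂ] ℂ := AlgHom.ofLinearMap ψ hone hmul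
  have key (a : A) : (∃ r : ℝ, ψ a = r) ↔
      a ∈ Submodule.span ℝ {u : A | u ∈ unitary A ∧ ∃ r : ℝ, φ u = r} := by
    refine ⟨fun ⟨r, hr⟩ ↦ mem_span_unitary_of_algHom_eq_ofReal φ hr, fun ha ↦ ?_⟩
    induction ha using Submodule.span_induction with
    | mem u hu => exact hu.2
    | zero => exact ⟨0, by simp⟩
    | add x y _ _ hx hy =>
      obtain ⟨⟨r, hr⟩, s, hs⟩ := hx, hy
      exact ⟨r + s, by simp [hr, hs]⟩
    | smul c x _ hx =>
      obtain ⟨r, hr⟩ := hx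
      exact ⟨c * r, by rw [← Complex.coe_smul, map_smul, hr]; simp⟩
  simp only [key]
  exact strongMankiewiczProp_ball_span fun u hu ↦ mem_extremePoints_closedBall_of_mem_unitary hu.1
end
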